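/- There exist absolute constants C₁ and C₂ such that the following holds. Let G be an abelian group, let d, k ≥ 1 be integers, and let X ⊆ G be a non-empty finite set such that k^d·|X| ≥ 2^{2^{C₂·d²·2^{6d}}}·|kX|, where kX is the k-fold iterated sumset of X. Then there exists a 2-proper symmetric coset-progression H + P in G of rank d' with 0 ≤ d' ≤ d and size |H + P| ≤ 2^d·(C₁d)^{3d²/2}·2^{d·2^{C₂·d²·2^{6d}}}·|kX| such that kX ⊆ H + P. -/

import Mathlib

open Pointwise

/-- A generalized arithmetic progression (GAP) of rank `r` in an additive abelian group,
given by its generators and dimensions. -/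
structure GAPData (G : Type*) [AddCommGroup G] (r : ℕ) where
  g₀ : G
  g : Fin r → G
  N : Fin r → ℤ
  N' : Fin r → ℤ
  hle : ∀ i, N i ≤ N' i

namespace GAPData

variable {G : Type*} [AddCommGroup G] {r : ℕ}

/-- The set of elements of the GAP. -/
def toSet (P : GAPData G r) : Set G :=
  {x | ∃ m : Fin r → ℤ, (∀ i, P.N i ≤ m i ∧ m i ≤ P.N' i) ∧ x = P.g₀ + ∑ i, m i • P.g i}

/-- A GAP is proper if every element has a unique representation. -/
def IsProper (P : GAPData G r) : Prop :=
  ∀ m m' : Fin r → ℤ, (∀ i, P.N i ≤ m i ∧ m i ≤ P.N' i) →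
    (∀ i, P.N i ≤ m' i ∧ m' i ≤ P.N' i) →
    P.g₀ + ∑ i, m i • P.g i = P.g₀ + ∑ i, m' i • P.g i → m = m'

/-- A GAP is symmetric if `g₀ = 0` and `N i = -N' i` for all `i`. -/
def IsSymmetric (P : GAPData G r) : Prop :=
  P.g₀ = 0 ∧ ∀ i, P.N i = -P.N' i

/-- The `t`-fold dilate `P_t` of a GAP, whose dimensions are multiplied by `t`. -/
def dilate (P : GAPData G r) (t : ℕ) : GAPData G r where
  g₀ := P.g₀
  g := P.g
  N := fun i => (t : ℤ) * P.N i
  N' := fun i => (t : ℤ) * P.N' i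
  hle := fun i => mul_le_mul_of_nonneg_left (P.hle i) (Int.natCast_nonneg t)

end GAPData

/-- `H + P` is a proper coset-progression: `H` is a finite subgroup, `P` is a proper GAP and
`|H + P| = |H| * |P|`. -/
def IsProperCosetProg {G : Type*} [AddCommGroup G] {r : ℕ}
    (H : AddSubgroup G) (P : GAPData G r) : Prop :=
  (H : Set G).Finite ∧ P.IsProper ∧
    ((H : Set G) + P.toSet).ncard = (H : Set G).ncard * P.toSet.ncard

/-- A symmetric coset-progression `H + P` is `t`-proper if `H + P_t` is proper. -/
def IsTProperCosetProg {G : Type*} [AddCommGroup G] (t : ℕ) {r : ℕ}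
    (H : AddSubgroup G) (P : GAPData G r) : Prop :=
  IsProperCosetProg H (P.dilate t)

/-- The `k`-fold iterated sumset `kX = X + ⋯ + X`. -/
def iterSumset {G : Type*} [AddCommGroup G] : ℕ → Set G → Set G
  | 0, _ => {0}
  | k + 1, X => X + iterSumset k X

section LatticeGeometry

variable {E : Type*} [NormedAddCommGroup E] [NormedSpace ℝ E]

/-- The norm of `e` modulo the subspace `V`. -/
noncomputable def modNorm (V : Submodule ℝ E) (e : E) : ℝ := ‖V.mkQ e‖

lemma modNorm_nonneg (V : Submodule ℝ E) (e : E) : 0 ≤ modNorm V e := norm_nonneg _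

lemma modNorm_add_le (V : Submodule ℝ E) (e f : E) :
    modNorm V (e + f) ≤ modNorm V e + modNorm V f := by
  unfold modNorm; rw [map_add]; exact norm_add_le _ _

lemma modNorm_sub_le (V : Submodule ℝ E) (e f : E) :
    modNorm V (e - f) ≤ modNorm V e + modNorm V f := by
  unfold modNorm; rw [map_sub]; exact norm_sub_le _ _

lemma modNorm_sum_le (V : Submodule ℝ E) {α : Type*} (s : Finset α) (f : α → E) :
    modNorm V (∑ i ∈ s, f i) ≤ ∑ i ∈ s, modNorm V (f i) := by
  unfold modNorm; rw [map_sum]; exact norm_sum_le _ _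

lemma modNorm_smul (V : Submodule ℝ E) (t : ℝ) (e : E) :
    modNorm V (t • e) = |t| * modNorm V e := by
  unfold modNorm; rw [map_smul, norm_smul, Real.norm_eq_abs]

lemma modNorm_le_norm (V : Submodule ℝ E) (e : E) : modNorm V e ≤ ‖e‖ :=
  Submodule.Quotient.norm_mk_le (S := V) e

lemma modNorm_eq_zero_of_mem {V : Submodule ℝ E} {e : E} (h : e ∈ V) : modNorm V e = 0 := by
  unfold modNorm
  rw [(Submodule.Quotient.mk_eq_zero V).2 h |> fun h' => (show V.mkQ e = 0 from h'), norm_zero]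

lemma modNorm_congr {V : Submodule ℝ E} {e f : E} (h : e - f ∈ V) :
    modNorm V e = modNorm V f := by
  unfold modNorm
  rw [show V.mkQ e = V.mkQ f from (Submodule.Quotient.eq V).2 h]

lemma modNorm_bot (e : E) : modNorm ⊥ e = ‖e‖ := by
  refine le_antisymm (modNorm_le_norm _ _) (le_of_forall_pos_le_add fun ε hε => ?_)
  obtain ⟨m, hm, hlt⟩ := Submodule.Quotient.norm_mk_lt (S := (⊥ : Submodule ℝ E))
    (Submodule.Quotient.mk e) hε
  have : m - e ∈ (⊥ : Submodule ℝ E) := (Submodule.Quotient.eq _).1 hm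
  rw [Submodule.mem_bot, sub_eq_zero] at this
  subst this
  exact hlt.le

lemma mem_of_modNorm_eq_zero [FiniteDimensional ℝ E] {V : Submodule ℝ E} {e : E}
    (h : modNorm V e = 0) : e ∈ V := by
  have hc : IsClosed (V : Set E) := Submodule.closed_of_finiteDimensional V
  have h2 : ‖(QuotientAddGroup.mk e : E ⧸ V.toAddSubgroup)‖ = 0 := h
  have h3 := QuotientAddGroup.norm_mk_eq_zero_iff_mem_closure.1 h2
  rw [show ((V.toAddSubgroup : AddSubgroup E) : Set E) = V from rfl, hc.closure_eq] at h3
  exact h3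

lemma modNorm_pos [FiniteDimensional ℝ E] {V : Submodule ℝ E} {e : E}
    (h : e ∉ V) : 0 < modNorm V e :=
  lt_of_le_of_ne (modNorm_nonneg _ _) fun h0 => h (mem_of_modNorm_eq_zero h0.symm)

lemma exists_real_modNorm_sub_le (V : Submodule ℝ E) (w e : E) {ε : ℝ} (hε : 0 < ε) :
    ∃ t : ℝ, modNorm V (e - t • w) ≤ modNorm (V ⊔ Submodule.span ℝ {w}) e + ε := by
  obtain ⟨m, hm, hlt⟩ := Submodule.Quotient.norm_mk_lt
    (S := V ⊔ Submodule.span ℝ {w}) (Submodule.Quotient.mk e) hε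
  have h1 : e - m ∈ V ⊔ Submodule.span ℝ {w} := (Submodule.Quotient.eq _).1 hm.symm
  obtain ⟨v, hv, y, hy, hvy⟩ := Submodule.mem_sup.1 h1
  obtain ⟨t, rfl⟩ := Submodule.mem_span_singleton.1 hy
  refine ⟨t, ?_⟩
  have : modNorm V (e - t • w) = modNorm V m := modNorm_congr (by
    have : e - t • w - m = v := by
      rw [sub_right_comm, ← hvy]; abel
    rwa [this])
  rw [this]
  exact (modNorm_le_norm V m).trans hlt.le

lemma exists_int_modNorm_sub_le (V : Submodule ℝ E) (w e : E) {ε : ℝ} (hε : 0 < ε) :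
    ∃ b : ℤ, modNorm V (e - b • w) ≤
      modNorm (V ⊔ Submodule.span ℝ {w}) e + modNorm V w / 2 + ε := by
  obtain ⟨t, ht⟩ := exists_real_modNorm_sub_le V w e hε
  refine ⟨round t, ?_⟩
  have h1 : e - (round t) • w = (e - t • w) + (t - round t) • w := by
    rw [sub_smul, Int.cast_smul_eq_zsmul]; abel
  rw [h1]
  have h2 := modNorm_add_le V (e - t • w) ((t - round t) • w)
  rw [modNorm_smul] at h2
  have h3 := abs_sub_round t
  have h4 := mul_le_mul_of_nonneg_right h3 (modNorm_nonneg V w)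
  linarith

variable {Λ : Type*} [AddCommGroup Λ] (j : Λ →+ E)

/-- The image of `j` is discrete modulo `V`. -/
def DiscreteMod (V : Submodule ℝ E) : Prop :=
  ∀ R : ℝ, {y : E ⧸ V | (∃ x, V.mkQ (j x) = y) ∧ ‖y‖ ≤ R}.Finite

lemma DiscreteMod.sup_span {j : Λ →+ E} {V : Submodule ℝ E} (h : DiscreteMod j V) (v : Λ) :
    DiscreteMod j (V ⊔ Submodule.span ℝ {j v}) := by
  intro R
  refine ((h (R + modNorm V (j v) / 2 + 1)).image
    (Submodule.factor (le_sup_left : V ≤ V ⊔ Submodule.span ℝ {j v}))).subset ?_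
  rintro y ⟨⟨x, rfl⟩, hx⟩
  obtain ⟨b, hb⟩ := exists_int_modNorm_sub_le V (j v) (j x) one_pos
  refine ⟨V.mkQ (j (x - b • v)), ⟨⟨_, rfl⟩, ?_⟩, ?_⟩
  · rw [map_sub, map_zsmul]
    refine hb.trans ?_
    have : modNorm (V ⊔ Submodule.span ℝ {j v}) (j x) ≤ R := hx
    linarith
  · rw [Submodule.factor_mk]
    refine (Submodule.Quotient.eq _).2 ?_
    rw [map_sub, map_zsmul, sub_sub_cancel_left, neg_mem_iff]
    exact zsmul_mem (Submodule.mem_sup_right (Submodule.mem_span_singleton_self _)) _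

lemma DiscreteMod.exists_min [FiniteDimensional ℝ E] {j : Λ →+ E} {V : Submodule ℝ E}
    (h : DiscreteMod j V) {x₀ : Λ} (hx₀ : j x₀ ∉ V) :
    ∃ v, j v ∉ V ∧ ∀ x, j x ∉ V → modNorm V (j v) ≤ modNorm V (j x) := by
  have hfin : {y : E ⧸ V | (∃ x, j x ∉ V ∧ V.mkQ (j x) = y) ∧ ‖y‖ ≤ modNorm V (j x₀)}.Finite :=
    (h (modNorm V (j x₀))).subset (by rintro y ⟨⟨x, _, hx⟩, hy⟩; exact ⟨⟨x, hx⟩, hy⟩)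
  obtain ⟨y, ⟨⟨v, hv, rfl⟩, hy⟩, hmin⟩ := hfin.exists_minimalFor (fun y => ‖y‖) _
    ⟨V.mkQ (j x₀), ⟨x₀, hx₀, rfl⟩, le_refl _⟩
  refine ⟨v, hv, fun x hx => ?_⟩
  by_contra! hlt
  have h1 : ‖V.mkQ (j x)‖ < ‖V.mkQ (j v)‖ := hlt
  exact absurd (hmin ⟨⟨x, hx, rfl⟩, h1.le.trans hy⟩ h1.le) (not_le.2 h1)

/-- The distortion constant of a reduced basis. -/
def reductionConst : ℕ → ℕ
  | 0 => 1
  | n + 1 => 4 * (n + 1) * reductionConst n + 1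

lemma one_le_reductionConst (n : ℕ) : 1 ≤ reductionConst n := by
  cases n <;> simp [reductionConst]

theorem exists_reduced_basis [FiniteDimensional ℝ E] (j : Λ →+ E) (n : ℕ) :
    ∀ V : Submodule ℝ E, DiscreteMod j V → Module.finrank ℝ E ≤ Module.finrank ℝ V + n →
    ∃ (r : ℕ) (v : Fin r → Λ), r ≤ n ∧ (∀ i, j (v i) ∉ V) ∧
      (∀ x, ∃ m : Fin r → ℤ, j (x - ∑ i, m i • v i) ∈ V ∧
        ∀ i, |(m i : ℝ)| * modNorm V (j (v i)) ≤ reductionConst n * modNorm V (j x)) ∧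
      ∀ m : Fin r → ℤ, j (∑ i, m i • v i) ∈ V → m = 0 := by
  induction n with
  | zero =>
    intro V _ hV
    have hT : V = ⊤ := Submodule.eq_top_of_finrank_eq
      (le_antisymm (Submodule.finrank_le V) (by simpa using hV))
    subst hT
    exact ⟨0, Fin.elim0, le_rfl, fun i => i.elim0, fun x => ⟨0, by simp, fun i => i.elim0⟩,
      fun m _ => Subsingleton.elim _ _⟩
  | succ n ih =>
    intro V hD hV
    by_cases hx₀ : ∀ x, j x ∈ V
    · exact ⟨0, Fin.elim0, Nat.zero_le _, fun i => i.elim0,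
        fun x => ⟨0, by simpa using hx₀ x, fun i => i.elim0⟩, fun m _ => Subsingleton.elim _ _⟩
    push Not at hx₀
    obtain ⟨x₀, hx₀⟩ := hx₀
    obtain ⟨v, hv, hmin⟩ := hD.exists_min hx₀
    have hvpos := modNorm_pos hv
    set V' := V ⊔ Submodule.span ℝ {j v} with hV'
    have hvV' : j v ∈ V' := Submodule.mem_sup_right (Submodule.mem_span_singleton_self _)
    have hlt : V < V' := lt_of_le_of_ne le_sup_left (fun h => hv (h ▸ hvV'))
    have hfr := Submodule.finrank_lt_finrank_of_lt hlt
    obtain ⟨r, w, hr, hw, hred, hind⟩ := ih V' (hD.sup_span v) (by omega)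
    choose b hb using fun i => exists_int_modNorm_sub_le V (j v) (j (w i))
      (show 0 < modNorm V (j v) / 4 by positivity)
    set u : Fin r → Λ := fun i => w i - b i • v with hu
    have huV' : ∀ i, j (u i) ∉ V' := by
      intro i hi
      apply hw i
      have : j (w i) = j (u i) + b i • j v := by simp [hu]
      rw [this]
      exact add_mem hi (zsmul_mem hvV' _)
    have hle : V ≤ V' := le_sup_left
    have hu4 : ∀ i, modNorm V (j (u i)) ≤ 4 * modNorm V' (j (w i)) := by
      intro i
      have h1 := hmin (u i) (fun h => huV' i (hle h))
      have h2 := hb i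
      rw [← map_zsmul, ← map_sub] at h2
      change modNorm V (j (u i)) ≤ _ at h2
      linarith
    have hq' : ∀ e, modNorm V' e ≤ modNorm V e := by
      intro e
      refine le_of_forall_pos_le_add fun ε hε => ?_
      obtain ⟨m, hm, hlt⟩ := Submodule.Quotient.norm_mk_lt (S := V) (Submodule.Quotient.mk e) hε
      have : modNorm V' e = modNorm V' m :=
        modNorm_congr (hle ((Submodule.Quotient.eq V).1 hm.symm))
      rw [this]
      exact (modNorm_le_norm _ _).trans hlt.le
    have hsum : ∀ m : Fin r → ℤ, j (∑ i, m i • w i) - j (∑ i, m i • u i) ∈ V' := by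
      intro m
      rw [← map_sub, ← Finset.sum_sub_distrib, map_sum]
      refine sum_mem fun i _ => ?_
      rw [← smul_sub, map_zsmul]
      refine zsmul_mem ?_ _
      simp only [hu, sub_sub_cancel, map_zsmul]
      exact zsmul_mem hvV' _
    refine ⟨r + 1, Fin.cons v u, by omega, ?_, ?_, ?_⟩
    · intro i
      refine Fin.cases ?_ (fun i => ?_) i
      · simpa using hv
      · simpa using fun h => huV' i (hle h)
    · intro x
      obtain ⟨m, hm, hmb⟩ := hred x
      have hmu : ∀ i, |(m i : ℝ)| * modNorm V (j (u i)) ≤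
          4 * reductionConst n * modNorm V (j x) := by
        intro i
        have h1 := mul_le_mul_of_nonneg_left (hu4 i) (abs_nonneg (m i : ℝ))
        have h2 := hmb i
        have h3 := mul_le_mul_of_nonneg_left (hq' (j x))
          (Nat.cast_nonneg (α := ℝ) (reductionConst n))
        linarith
      set y := x - ∑ i, m i • u i with hy
      have hyV' : j y ∈ V' := by
        have h1 := add_mem hm (hsum m)
        rw [← map_sub, ← map_add] at h1
        convert h1 using 2
        rw [hy]; abel
      obtain ⟨a, ha, z, hz, haz⟩ := Submodule.mem_sup.1 hyV'
      obtain ⟨t, rfl⟩ := Submodule.mem_span_singleton.1 hz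
      have hqy : ∀ s : ℝ, modNorm V (j y - s • j v) = |t - s| * modNorm V (j v) := by
        intro s
        rw [← modNorm_smul]
        refine modNorm_congr ?_
        rw [← haz, sub_smul]
        convert ha using 1
        abel
      have hround : j (y - round t • v) ∈ V := by
        by_contra hcon
        have h1 := hmin _ hcon
        have h2 := hqy (round t)
        rw [Int.cast_smul_eq_zsmul, ← map_zsmul, ← map_sub] at h2
        rw [h2] at h1
        have h3 := mul_le_mul_of_nonneg_right (abs_sub_round t) hvpos.le
        linarith
      have hroundq : |(round t : ℝ)| * modNorm V (j v) ≤
          reductionConst (n + 1) * modNorm V (j x) := by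
        rw [← modNorm_smul]
        have h0 : modNorm V ((round t : ℝ) • j v) = modNorm V (j y) := by
          refine (modNorm_congr ?_).symm
          rw [Int.cast_smul_eq_zsmul, ← map_zsmul, ← map_sub]
          exact hround
        have h1 : modNorm V (j y) ≤ modNorm V (j x) +
            ∑ i, |(m i : ℝ)| * modNorm V (j (u i)) := by
          rw [hy, map_sub, map_sum]
          refine (modNorm_sub_le _ _ _).trans (add_le_add_right ((modNorm_sum_le _ _ _).trans
            (Finset.sum_le_sum fun i _ => ?_)) _)
          rw [map_zsmul, ← Int.cast_smul_eq_zsmul ℝ, modNorm_smul]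
        have h2 : ∑ i, |(m i : ℝ)| * modNorm V (j (u i)) ≤
            r * (4 * reductionConst n * modNorm V (j x)) := by
          refine (Finset.sum_le_sum fun i _ => hmu i).trans ?_
          simp
        have h3 : (r : ℝ) ≤ n + 1 := by exact_mod_cast hr.trans (Nat.le_succ n)
        have h4 : (r : ℝ) * (4 * reductionConst n * modNorm V (j x)) ≤
            (n + 1) * (4 * reductionConst n * modNorm V (j x)) :=
          mul_le_mul_of_nonneg_right h3 (by have := modNorm_nonneg V (j x); positivity)
        have h5 : (reductionConst (n + 1) : ℝ) = 4 * (n + 1) * reductionConst n + 1 := by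
          simp [reductionConst]
        rw [h0, h5]
        linarith
      refine ⟨Fin.cons (round t) m, ?_, ?_⟩
      · rw [Fin.sum_univ_succ]
        simp only [Fin.cons_zero, Fin.cons_succ]
        convert hround using 2
        rw [hy]; abel
      · intro i
        refine Fin.cases ?_ (fun i => ?_) i
        · simpa using hroundq
        · simp only [Fin.cons_succ]
          refine (hmu i).trans (mul_le_mul_of_nonneg_right ?_ (modNorm_nonneg _ _))
          have h5 : (reductionConst (n + 1) : ℝ) = 4 * (n + 1) * reductionConst n + 1 := by
            simp [reductionConst]
          rw [h5]
          have : (0 : ℝ) ≤ n * reductionConst n := by positivity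
          nlinarith
    · intro m hm
      rw [Fin.sum_univ_succ] at hm
      simp only [Fin.cons_zero, Fin.cons_succ] at hm
      have hm' : (fun i : Fin r => m i.succ) = 0 := by
        refine hind _ ?_
        have h1 := hsum (fun i => m i.succ)
        have h2 : j (∑ i : Fin r, m i.succ • u i) ∈ V' := by
          have h3 := sub_mem (hle hm) (zsmul_mem hvV' (m 0))
          rw [map_add, map_zsmul, add_sub_cancel_left] at h3
          exact h3
        simpa using add_mem h1 h2
      have hm0 : m 0 = 0 := by
        by_contra hne
        apply hv
        have h1 : ∀ i : Fin r, m i.succ = 0 := fun i => congrFun hm' i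
        simp only [h1, zero_smul, Finset.sum_const_zero, add_zero, map_zsmul] at hm
        rw [← Int.cast_smul_eq_zsmul ℝ] at hm
        exact (Submodule.smul_mem_iff V (by exact_mod_cast hne)).1 hm
      funext i
      refine Fin.cases hm0 (fun i => congrFun hm' i) i

theorem exists_absorbing_subspace [FiniteDimensional ℝ E] (j : Λ →+ E) (R : AddSubgroup Λ)
    {t : ℝ} (ht : 0 < t) (n : ℕ) :
    ∀ V : Submodule ℝ E, DiscreteMod j V → Module.finrank ℝ E ≤ Module.finrank ℝ V + n →
    ∃ V' : Submodule ℝ E, V ≤ V' ∧ DiscreteMod j V' ∧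
      (∀ x, ∃ x', x - x' ∈ R ∧ j (x - x') ∈ V' ∧
        modNorm V (j x') ≤ modNorm V' (j x) + n * t) ∧
      ∀ ρ ∈ R, modNorm V' (j ρ) ≤ t → j ρ ∈ V' := by
  induction n with
  | zero =>
    intro V hD hV
    have hT : V = ⊤ := Submodule.eq_top_of_finrank_eq
      (le_antisymm (Submodule.finrank_le V) (by simpa using hV))
    subst hT
    exact ⟨⊤, le_rfl, hD, fun x => ⟨x, by simp, by simp, by simp⟩, by simp⟩
  | succ n ih =>
    intro V hD hV
    by_cases hR : ∀ ρ ∈ R, modNorm V (j ρ) ≤ t → j ρ ∈ V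
    · refine ⟨V, le_rfl, hD, fun x => ⟨x, by simp, by simp, ?_⟩, hR⟩
      have : 0 ≤ ((n + 1 : ℕ) : ℝ) * t := by positivity
      linarith
    push Not at hR
    obtain ⟨ρ, hρR, hρt, hρV⟩ := hR
    set V₁ := V ⊔ Submodule.span ℝ {j ρ} with hV₁
    have hρV₁ : j ρ ∈ V₁ := Submodule.mem_sup_right (Submodule.mem_span_singleton_self _)
    have hlt : V < V₁ := lt_of_le_of_ne le_sup_left (fun h => hρV (h ▸ hρV₁))
    have hfr := Submodule.finrank_lt_finrank_of_lt hlt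
    obtain ⟨V', hle, hD', hred, hR'⟩ := ih V₁ (hD.sup_span ρ) (by omega)
    refine ⟨V', hlt.le.trans hle, hD', fun x => ?_, hR'⟩
    obtain ⟨x', h1, h2, h3⟩ := hred x
    obtain ⟨b, hb⟩ := exists_int_modNorm_sub_le V (j ρ) (j x') (half_pos ht)
    have hx : x - (x' - b • ρ) = (x - x') + b • ρ := by abel
    refine ⟨x' - b • ρ, ?_, ?_, ?_⟩
    · rw [hx]; exact add_mem h1 (zsmul_mem hρR _)
    · rw [hx, map_add, map_zsmul]; exact add_mem h2 (zsmul_mem (hle hρV₁) _)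
    · rw [map_sub, map_zsmul]
      push_cast
      linarith

end LatticeGeometry

section CosetProgressions

variable {ι : Type*} {G : Type*} [AddCommGroup G]

/-- The integer points of the box with side half-lengths `ℓ`. -/
def intBox (ℓ : ι → ℕ) : Set (ι → ℤ) := {m | ∀ i, |m i| ≤ ℓ i}

/-- The coset progression with subgroup `H`, parametrised by `φ` on the box `ℓ`. -/
def cosetProg (H : AddSubgroup G) (φ : (ι → ℤ) →+ G) (ℓ : ι → ℕ) : Set G :=
  {g | ∃ m ∈ intBox ℓ, g - φ m ∈ H}

lemma intBox_mono {ℓ ℓ' : ι → ℕ} (h : ∀ i, ℓ i ≤ ℓ' i) : intBox ℓ ⊆ intBox ℓ' :=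
  fun _ hm i => (hm i).trans (by exact_mod_cast h i)

lemma cosetProg_mono {H : AddSubgroup G} {φ : (ι → ℤ) →+ G} {ℓ ℓ' : ι → ℕ}
    (h : ∀ i, ℓ i ≤ ℓ' i) : cosetProg H φ ℓ ⊆ cosetProg H φ ℓ' :=
  fun _ ⟨m, hm, hg⟩ => ⟨m, intBox_mono h hm, hg⟩

lemma finite_intBox [Finite ι] (ℓ : ι → ℕ) : (intBox ℓ).Finite := by
  refine (Set.Finite.pi' (t := fun i => Set.Icc (-(ℓ i : ℤ)) (ℓ i))
    fun i => Set.finite_Icc _ _).subset ?_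
  intro m hm i
  exact abs_le.1 (hm i)

lemma finite_cosetProg [Finite ι] {H : AddSubgroup G} (hH : (H : Set G).Finite)
    (φ : (ι → ℤ) →+ G) (ℓ : ι → ℕ) : (cosetProg H φ ℓ).Finite := by
  refine (Set.Finite.image2 (fun h m => h + φ m) hH (finite_intBox ℓ)).subset ?_
  rintro g ⟨m, hm, hg⟩
  exact ⟨g - φ m, hg, m, hm, by simp⟩

lemma intBox_add {ℓ ℓ' : ι → ℕ} {m m' : ι → ℤ} (h : m ∈ intBox ℓ) (h' : m' ∈ intBox ℓ') :
    m + m' ∈ intBox (ℓ + ℓ') := fun i => by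
  have := abs_add_le (m i) (m' i)
  have := h i
  have := h' i
  simp only [Pi.add_apply, Nat.cast_add]
  linarith

lemma intBox_sub {ℓ ℓ' : ι → ℕ} {m m' : ι → ℤ} (h : m ∈ intBox ℓ) (h' : m' ∈ intBox ℓ') :
    m - m' ∈ intBox (ℓ + ℓ') := fun i => by
  have := abs_sub (m i) (m' i)
  have := h i
  have := h' i
  simp only [Pi.add_apply, Pi.sub_apply, Nat.cast_add]
  linarith

lemma zero_mem_intBox (ℓ : ι → ℕ) : (0 : ι → ℤ) ∈ intBox ℓ := fun i => by simp

/-- Rescaling of the integer lattice in which the box `ℓ` is the unit ball. -/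
noncomputable def scaledEmbedding (ℓ : ι → ℕ) : (ι → ℤ) →+ (ι → ℝ) where
  toFun x i := x i / ℓ i
  map_zero' := by ext; simp
  map_add' x y := by ext; simp [add_div]

variable [Fintype ι]

lemma norm_scaledEmbedding_le {ℓ : ι → ℕ} (hℓ : ∀ i, 1 ≤ ℓ i) (x : ι → ℤ) (s : ℕ) :
    ‖scaledEmbedding ℓ x‖ ≤ s ↔ x ∈ intBox (s • ℓ) := by
  rw [pi_norm_le_iff_of_nonneg (Nat.cast_nonneg s)]
  refine forall_congr' fun i => ?_
  have hpos : (0 : ℝ) < ℓ i := by exact_mod_cast hℓ i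
  simp only [scaledEmbedding, AddMonoidHom.coe_mk, ZeroHom.coe_mk, norm_div, Real.norm_eq_abs,
    Nat.abs_cast, Pi.smul_apply, smul_eq_mul]
  rw [div_le_iff₀ hpos]
  norm_cast

lemma discreteMod_bot {ℓ : ι → ℕ} (hℓ : ∀ i, 1 ≤ ℓ i) :
    DiscreteMod (scaledEmbedding ℓ) (⊥ : Submodule ℝ (ι → ℝ)) := by
  intro R
  refine ((finite_intBox (⌈R⌉₊ • ℓ)).image
    fun x => (⊥ : Submodule ℝ (ι → ℝ)).mkQ (scaledEmbedding ℓ x)).subset ?_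
  rintro y ⟨⟨x, rfl⟩, hx⟩
  refine ⟨x, (norm_scaledEmbedding_le hℓ x _).1 ?_, rfl⟩
  rw [← modNorm_bot]
  exact le_trans hx (Nat.le_ceil R)

/-- The dilation factor lost when a coset progression of rank `N` is made proper. -/
def properConst (N : ℕ) : ℕ :=
  N * reductionConst N + N * (4 * (N + 1) * reductionConst N)

theorem exists_proper_cosetProg (φ : (ι → ℤ) →+ G) (H : AddSubgroup G)
    (hH : (H : Set G).Finite) (ℓ : ι → ℕ) (hℓ : ∀ i, 1 ≤ ℓ i) :
    ∃ (r : ℕ) (H' : AddSubgroup G) (c : (ι → ℤ) →+ (Fin r → ℤ)) (ψ : (Fin r → ℤ) →+ G)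
      (L : Fin r → ℕ), r ≤ Fintype.card ι ∧ H ≤ H' ∧ (H' : Set G).Finite ∧
      Function.Surjective c ∧ (∀ x, φ x - ψ (c x) ∈ H') ∧
      (∀ x ∈ intBox ℓ, c x ∈ intBox L) ∧
      (∀ ρ ∈ intBox (4 • ℓ), φ ρ ∈ H → c ρ = 0) ∧
      (∀ m ∈ intBox (4 • L), ψ m ∈ H' → m = 0) ∧
      cosetProg H' ψ L ⊆ cosetProg H φ (properConst (Fintype.card ι) • ℓ) := by
  set N := Fintype.card ι with hN
  set j := scaledEmbedding ℓ with hj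
  set C := reductionConst N with hC
  have hC1 : 1 ≤ C := one_le_reductionConst N
  set T : ℕ := 4 * (N + 1) * C with hT
  have hTpos : (0 : ℝ) < T := by
    have : 0 < T := by positivity
    exact_mod_cast this
  have hrank : Module.finrank ℝ (ι → ℝ) = N := by simp [hN]
  obtain ⟨V, -, hD, hred, hrel⟩ := exists_absorbing_subspace j (H.comap φ) hTpos N ⊥
    (discreteMod_bot hℓ) (by rw [hrank]; omega)
  obtain ⟨r, v, hr, hv, hbas, hind⟩ := exists_reduced_basis j N V hD (by rw [hrank]; omega)
  choose x' hx'1 hx'2 hx'3 using hred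
  choose c₀ hc₀ hc₀b using hbas
  have huniq : ∀ x (m : Fin r → ℤ), j (x - ∑ i, m i • v i) ∈ V → c₀ x = m := by
    intro x m hm
    have h1 := sub_mem hm (hc₀ x)
    rw [← map_sub] at h1
    have h2 := hind (c₀ x - m) (by
      convert h1 using 2
      simp only [Pi.sub_apply, sub_smul, Finset.sum_sub_distrib]
      abel)
    exact sub_eq_zero.1 h2
  let lift : (Fin r → ℤ) →+ (ι → ℤ) :=
    { toFun := fun m => ∑ i, m i • v i
      map_zero' := by simp
      map_add' := fun a b => by simp [add_smul, Finset.sum_add_distrib] }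
  have hlift : ∀ m, lift m = ∑ i, m i • v i := fun m => rfl
  let c : (ι → ℤ) →+ (Fin r → ℤ) :=
    { toFun := c₀
      map_zero' := huniq _ _ (by simp)
      map_add' := fun a b => huniq _ _ (by
        have h := add_mem (hc₀ a) (hc₀ b)
        rw [← map_add] at h
        convert h using 2
        simp only [Pi.add_apply, add_smul, Finset.sum_add_distrib]
        abel) }
  have hc : ∀ x, j (x - lift (c x)) ∈ V := hc₀
  have hcu : ∀ x m, j (x - lift m) ∈ V → c x = m := huniq
  have hclift : ∀ m, c (lift m) = m := fun m => hcu _ _ (by simp)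
  have hker : ∀ x, c x = 0 ↔ j x ∈ V := by
    intro x
    constructor
    · intro h; simpa [h] using hc x
    · intro h; exact hcu x 0 (by simpa using h)
  have hpos : ∀ i, 0 < modNorm V (j (v i)) := fun i => modNorm_pos (hv i)
  set L : Fin r → ℕ := fun i => ⌊(C : ℝ) / modNorm V (j (v i))⌋₊ with hL
  have hLb : ∀ i, (L i : ℝ) * modNorm V (j (v i)) ≤ C := by
    intro i
    rw [← le_div_iff₀ (hpos i)]
    exact Nat.floor_le (div_nonneg (Nat.cast_nonneg _) (hpos i).le)
  have hliftq : ∀ (s : ℕ) (m : Fin r → ℤ), m ∈ intBox (s • L) →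
      modNorm V (j (lift m)) ≤ N * (s * C) := by
    intro s m hm
    rw [hlift, map_sum]
    refine (modNorm_sum_le _ _ _).trans ?_
    have h1 : ∀ i ∈ Finset.univ, modNorm V (j (m i • v i)) ≤ s * C := by
      intro i _
      rw [map_zsmul, ← Int.cast_smul_eq_zsmul ℝ, modNorm_smul]
      have h2 : |(m i : ℝ)| ≤ s * L i := by
        have := hm i
        simp only [Pi.smul_apply, smul_eq_mul] at this
        exact_mod_cast this
      calc |(m i : ℝ)| * modNorm V (j (v i)) ≤ s * L i * modNorm V (j (v i)) :=
            mul_le_mul_of_nonneg_right h2 (hpos i).le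
        _ = s * (L i * modNorm V (j (v i))) := by ring
        _ ≤ s * C := mul_le_mul_of_nonneg_left (hLb i) (Nat.cast_nonneg _)
    refine (Finset.sum_le_sum h1).trans ?_
    simp only [Finset.sum_const, Finset.card_univ, Fintype.card_fin, nsmul_eq_mul]
    exact mul_le_mul_of_nonneg_right (by exact_mod_cast hr) (by positivity)
  have hqbox : ∀ (s : ℕ) (x : ι → ℤ), x ∈ intBox (s • ℓ) → modNorm V (j x) ≤ s :=
    fun s x hx => (modNorm_le_norm _ _).trans ((norm_scaledEmbedding_le hℓ x s).2 hx)
  set H' : AddSubgroup G := H ⊔ c.ker.map φ with hH'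
  have hx'box : ∀ (x : ι → ℤ) (s : ℕ), modNorm V (j x) ≤ s →
      x' x ∈ intBox ((s + N * T) • ℓ) := by
    intro x s hs
    rw [← norm_scaledEmbedding_le hℓ, ← modNorm_bot]
    refine (hx'3 x).trans ?_
    push_cast
    linarith
  refine ⟨r, H', c, φ.comp lift, L, hr, le_sup_left, ?_, fun m => ⟨lift m, hclift m⟩, ?_, ?_, ?_,
    ?_, ?_⟩
  · refine (finite_cosetProg hH φ ((0 + N * T) • ℓ)).subset ?_
    intro g hg
    obtain ⟨h, hh, y, hy, rfl⟩ := AddSubgroup.mem_sup.1 hg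
    obtain ⟨x, hx, rfl⟩ := hy
    have hxV : j x ∈ V := (hker x).1 hx
    refine ⟨x' x, hx'box x 0 (by rw [modNorm_eq_zero_of_mem hxV]; simp), ?_⟩
    have : h + φ x - φ (x' x) = h + φ (x - x' x) := by rw [map_sub]; abel
    rw [this]
    exact add_mem hh (hx'1 x)
  · intro x
    refine AddSubgroup.mem_sup_right ⟨x - lift (c x), ?_, by simp⟩
    exact (hker _).2 (hc x)
  · intro x hx i
    have h1 : |((c x i : ℤ) : ℝ)| * modNorm V (j (v i)) ≤ C := by
      refine (hc₀b x i).trans ?_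
      have := hqbox 1 x (by simpa using hx)
      have h2 := mul_le_mul_of_nonneg_left this (Nat.cast_nonneg (α := ℝ) C)
      simpa using h2
    rw [← le_div_iff₀ (hpos i)] at h1
    have h3 : (c x i).natAbs ≤ L i := Nat.le_floor (by
      rw [Nat.cast_natAbs]; exact_mod_cast h1)
    rw [Int.abs_eq_natAbs]
    exact_mod_cast h3
  · intro ρ hρ hφ
    rw [hker]
    refine hrel ρ hφ ((hqbox 4 ρ hρ).trans ?_)
    have : 4 ≤ T := by
      rw [hT]
      calc 4 = 4 * 1 * 1 := rfl
        _ ≤ _ := Nat.mul_le_mul (Nat.mul_le_mul_left _ (by omega)) hC1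
    exact_mod_cast this
  · intro m hm hψ
    obtain ⟨h, hh, y, hy, hs⟩ := AddSubgroup.mem_sup.1 hψ
    obtain ⟨x, hx, rfl⟩ := hy
    have hxV : j x ∈ V := (hker x).1 hx
    have hρ : φ (lift m - x) ∈ H := by
      rw [map_sub, show φ (lift m) = h + φ x from hs.symm, add_sub_cancel_right]
      exact hh
    have hq : modNorm V (j (lift m - x)) = modNorm V (j (lift m)) :=
      modNorm_congr (by simpa using hxV)
    have h1 : j (lift m - x) ∈ V := by
      refine hrel _ hρ ?_
      rw [hq]
      refine (hliftq 4 m hm).trans ?_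
      have : N * (4 * C) ≤ T := by rw [hT]; nlinarith
      exact_mod_cast this
    have h2 : c (lift m) = 0 := (hker _).2 (by simpa using add_mem h1 hxV)
    rw [← hclift m, h2]
  · rintro g ⟨m, hm, hg⟩
    obtain ⟨h, hh, y, hy, hs⟩ := AddSubgroup.mem_sup.1 hg
    obtain ⟨z, hz, rfl⟩ := hy
    have hzV : j z ∈ V := (hker z).1 hz
    set x := lift m + z with hx
    have hq : modNorm V (j x) ≤ (N * C : ℕ) := by
      have h1 : modNorm V (j x) = modNorm V (j (lift m)) :=
        modNorm_congr (by simpa [hx] using hzV)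
      rw [h1]
      have := hliftq 1 m (by simpa using hm)
      push_cast
      simpa using this
    refine ⟨x' x, hx'box x _ hq, ?_⟩
    have h2 : g - φ (x' x) = h + φ (x - x' x) := by
      have : g = h + φ z + φ (lift m) := by
        rw [hs]; simp
      rw [this, map_sub, hx, map_add]; abel
    rw [h2]
    exact add_mem hh (hx'1 x)

end CosetProgressions

section Covering

variable {ι : Type*} {G : Type*} [AddCommGroup G]

lemma exists_int_decomposition (m : ℤ) (E ℓ : ℕ) (h : |m| ≤ (E * max ℓ 1 : ℕ)) :
    ∃ a b : ℤ, |a| ≤ E ∧ |b| ≤ ℓ ∧ m = a * (max ℓ 1 : ℕ) + b := by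
  wlog hm : 0 ≤ m generalizing m
  · obtain ⟨a, b, ha, hb, hab⟩ := this (-m) (by rwa [abs_neg]) (by omega)
    exact ⟨-a, -b, by rwa [abs_neg], by rwa [abs_neg], by linarith⟩
  have hw : (0 : ℤ) < (max ℓ 1 : ℕ) := by positivity
  have h1 := Int.emod_add_mul_ediv m (max ℓ 1 : ℕ)
  have h2 := Int.emod_nonneg m hw.ne'
  have h3 := Int.emod_lt_of_pos m hw
  have h4 : 0 ≤ m / (max ℓ 1 : ℕ) := Int.ediv_nonneg hm hw.le
  refine ⟨m / (max ℓ 1 : ℕ), m % (max ℓ 1 : ℕ), ?_, ?_, by linarith⟩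
  · rw [abs_of_nonneg h4]
    rw [abs_of_nonneg hm] at h
    push_cast at h h4 hw ⊢
    exact Int.ediv_le_of_le_mul hw h
  · rw [abs_of_nonneg h2]
    have : ((max ℓ 1 : ℕ) : ℤ) ≤ ℓ + 1 := by exact_mod_cast max_le (Nat.le_succ ℓ) (by omega)
    omega

section Card

variable [Fintype ι]

lemma ncard_intBox_const (E : ℕ) :
    (intBox (fun _ : ι => E)).ncard = (2 * E + 1) ^ Fintype.card ι := by
  classical
  have h : intBox (fun _ : ι => E) =
      (Fintype.piFinset (fun _ : ι => Finset.Icc (-(E : ℤ)) E) : Finset (ι → ℤ)) := by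
    ext m
    simp [intBox, abs_le, Pi.le_def, forall_and]
  rw [h, Set.ncard_coe_finset, Fintype.card_piFinset]
  simp only [Int.card_Icc, Finset.prod_const, Finset.card_univ]
  congr 1
  omega

theorem ncard_cosetProg_le {H : AddSubgroup G} (hH : (H : Set G).Finite) (φ : (ι → ℤ) →+ G)
    (ℓ : ι → ℕ) (E : ℕ) :
    (cosetProg H φ (E • fun i => max (ℓ i) 1)).ncard ≤
      (2 * E + 1) ^ Fintype.card ι * (cosetProg H φ ℓ).ncard := by
  classical
  have hfin := finite_cosetProg hH φ ℓ
  have hsub : cosetProg H φ (E • fun i => max (ℓ i) 1) ⊆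
      (fun p : (ι → ℤ) × G => φ (fun i => p.1 i * (max (ℓ i) 1 : ℕ)) + p.2) ''
        (intBox (fun _ : ι => E) ×ˢ cosetProg H φ ℓ) := by
    rintro g ⟨m, hm, hg⟩
    choose a b ha hb hab using fun i => exists_int_decomposition (m i) E (ℓ i) (hm i)
    refine ⟨(a, g - φ (fun i => a i * (max (ℓ i) 1 : ℕ))), ⟨ha, b, hb, ?_⟩, by simp⟩
    have : φ m = φ (fun i => a i * (max (ℓ i) 1 : ℕ)) + φ b := by
      rw [← map_add]; congr 1; funext i; exact hab i
    rw [this, ← sub_sub] at hg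
    exact hg
  have hprod := (finite_intBox (fun _ : ι => E)).prod hfin
  refine (Set.ncard_le_ncard hsub (hprod.image _)).trans ((Set.ncard_image_le hprod).trans ?_)
  rw [Set.ncard_prod, ncard_intBox_const]

end Card

lemma cosetProg_succ_subset (H : AddSubgroup G) (φ : (ι → ℤ) →+ G) (L : ι → ℕ) (j : ℕ) :
    cosetProg H φ ((j + 1) • L) ⊆ cosetProg H φ (j • L) + cosetProg H φ L := by
  rintro g ⟨m, hm, hg⟩
  set b : ι → ℤ := fun i => max (-(L i : ℤ)) (min (L i) (m i)) with hb
  have hbL : b ∈ intBox L := fun i => by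
    rw [abs_le]; exact ⟨le_max_left _ _, max_le (by omega) (min_le_left _ _)⟩
  refine ⟨g - φ b, ⟨m - b, fun i => ?_, ?_⟩, φ b, ⟨b, hbL, by simp⟩, by simp⟩
  · have h1 := hm i
    simp only [Pi.smul_apply, smul_eq_mul, Nat.cast_mul, Nat.cast_add, Nat.cast_one] at h1
    simp only [Pi.smul_apply, smul_eq_mul, Nat.cast_mul, Pi.sub_apply, hb]
    have h2 : (0 : ℤ) ≤ j * L i := by positivity
    have h3 : ((j : ℤ) + 1) * L i = j * L i + L i := by ring
    rw [h3] at h1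
    rw [abs_le] at h1 ⊢
    omega
  · rw [map_sub]
    convert hg using 1
    abel

lemma cosetProg_nsmul_subset {H : AddSubgroup G} {φ : (ι → ℤ) →+ G} {L : ι → ℕ}
    {S : Set G} (hS : cosetProg H φ L ⊆ S) (j : ℕ) :
    cosetProg H φ ((j + 1) • L) ⊆ (j + 1) • S := by
  induction j with
  | zero => simpa using hS
  | succ j ih =>
    rw [succ_nsmul S]
    exact (cosetProg_succ_subset H φ L (j + 1)).trans (Set.add_subset_add ih hS)

theorem ncard_cosetProg_le_of_sandwich [Fintype ι] [DecidableEq G] {H : AddSubgroup G}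
    (hH : (H : Set G).Finite) (φ : (ι → ℤ) →+ G) (L : ι → ℕ) (hL : ∀ i, 1 ≤ L i) (A : Finset G)
    (h0 : 0 ∈ A) {C κ : ℕ} (hC : cosetProg H φ L ⊆ (C • A - C • A : Finset G))
    (hκ : 5 ^ Fintype.card ι ≤ κ) (hA : (2 • A).card ≤ κ * A.card) (i : ℕ) :
    (cosetProg H φ (2 ^ i • L)).ncard ≤ κ ^ (2 * C + 1) * (2 ^ i • A).card := by
  have hκ1 : 1 ≤ κ := le_trans (Nat.one_le_pow _ _ (by norm_num)) hκ
  have hne : ∀ j : ℕ, (j • A).Nonempty := fun j => Finset.Nonempty.nsmul ⟨0, h0⟩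
  have hpl : ∀ j : ℕ, 1 ≤ j → (2 • (j • A)).card ≤ κ * (j • A).card →
      (cosetProg H φ (j • L)).ncard ≤ κ ^ (2 * C) * (j • A).card := by
    intro j hj hd
    have h1 : cosetProg H φ (j • L) ⊆ (C • (j • A) - C • (j • A) : Finset G) := by
      obtain ⟨j, rfl⟩ := Nat.exists_eq_add_of_le' hj
      refine (cosetProg_nsmul_subset hC j).trans ?_
      rw [← Finset.coe_nsmul, nsmul_sub, smul_comm]
    have h2 := Finset.pluennecke_ruzsa_inequality_nsmul_sub_nsmul_add (hne j) (j • A) C C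
    have h3 : ((j • A + j • A).card / (j • A).card : ℚ≥0) ≤ κ := by
      rw [div_le_iff₀ (by exact_mod_cast (hne j).card_pos), ← two_nsmul]
      exact_mod_cast hd
    have h4 : ((C • (j • A) - C • (j • A) : Finset G).card : ℚ≥0) ≤
        κ ^ (2 * C) * (j • A).card := by
      refine h2.trans (mul_le_mul_of_nonneg_right ?_ (by positivity))
      rw [two_mul]
      exact pow_le_pow_left₀ (by positivity) h3 _
    calc (cosetProg H φ (j • L)).ncard ≤ (C • (j • A) - C • (j • A) : Finset G).card := by
          rw [← Set.ncard_coe_finset]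
          exact Set.ncard_le_ncard h1 (Finset.finite_toSet _)
      _ ≤ _ := by exact_mod_cast h4
  induction i with
  | zero =>
    have := hpl 1 le_rfl (by simpa using hA)
    rw [pow_zero]
    refine this.trans (Nat.mul_le_mul_right _ (Nat.pow_le_pow_right hκ1 (by omega)))
  | succ i ih =>
    set j := 2 ^ i with hj
    have hj1 : 1 ≤ j := Nat.one_le_two_pow
    have hjj : 2 ^ (i + 1) = 2 * j := by rw [hj, pow_succ]; ring
    have hcov : (cosetProg H φ (2 ^ (i + 1) • L)).ncard ≤
        κ * (cosetProg H φ (j • L)).ncard := by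
      have h1 := ncard_cosetProg_le hH φ (j • L) 2
      have h2 : (2 • fun i => max ((j • L) i) 1) = 2 ^ (i + 1) • L := by
        funext i
        have : 1 ≤ j * L i := Nat.one_le_iff_ne_zero.2
          (Nat.mul_ne_zero (by omega) (by have := hL i; omega))
        simp only [Pi.smul_apply, smul_eq_mul, hjj]
        rw [max_eq_left this]; ring
      rw [h2] at h1
      exact h1.trans (Nat.mul_le_mul_right _ hκ)
    have h2j : 2 • (j • A) = 2 ^ (i + 1) • A := by rw [hjj, mul_nsmul']
    by_cases hd : (2 • (j • A)).card ≤ κ * (j • A).card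
    · refine hcov.trans ?_
      rw [pow_succ κ, mul_comm _ κ, mul_assoc]
      refine Nat.mul_le_mul_left _ ((hpl j hj1 hd).trans (Nat.mul_le_mul_left _ ?_))
      exact Finset.card_le_card (Finset.nsmul_subset_nsmul_right h0 (by omega))
    · push Not at hd
      rw [h2j] at hd
      calc _ ≤ κ * (κ ^ (2 * C + 1) * (j • A).card) := hcov.trans (Nat.mul_le_mul_left _ ih)
        _ = κ ^ (2 * C + 1) * (κ * (j • A).card) := by ring
        _ ≤ _ := Nat.mul_le_mul_left _ hd.le

end Covering

section Bogolyubov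

variable {α : Type*} [AddCommGroup α]

/-- The exponential sum of the character `χ` over `B`. -/
noncomputable def expSum (B : Finset α) (χ : AddChar α ℂ) : ℂ := ∑ b ∈ B, χ b

lemma norm_sub_mul_norm_expSum_le [Finite α] [DecidableEq α] (B A : Finset α) (h0 : 0 ∈ A) {a : α}
    (ha : a ∈ A) (χ : AddChar α ℂ) :
    ‖1 - χ a‖ * ‖expSum B χ‖ ≤ 2 * ((B + A).card - B.card : ℝ) := by
  set B' := B.map (addLeftEmbedding a) with hB'
  have hsum : χ a * expSum B χ = ∑ b ∈ B', χ b := by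
    simp [hB', expSum, Finset.mul_sum, AddChar.map_add_eq_mul]
  have hcard : B'.card = B.card := Finset.card_map _
  have hsub : B ∪ B' ⊆ B + A := by
    refine Finset.union_subset (fun b hb => ?_) (fun b hb => ?_)
    · simpa using Finset.add_mem_add hb h0
    · obtain ⟨c, hc, rfl⟩ := Finset.mem_map.1 hb
      rw [addLeftEmbedding_apply, add_comm a c]
      exact Finset.add_mem_add hc ha
  have hb : ∀ s : Finset α, ‖∑ x ∈ s, χ x‖ ≤ s.card := fun s => by
    refine (norm_sum_le _ _).trans ?_
    simp [AddChar.norm_apply]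
  have h1 : ((B \ B').card : ℝ) + B.card ≤ (B + A).card := by
    have h := Finset.card_sdiff_add_card B B'
    rw [hcard] at h
    have h' := Finset.card_le_card hsub
    exact_mod_cast h.trans_le h'
  have h2 : ((B' \ B).card : ℝ) + B.card ≤ (B + A).card := by
    have h := Finset.card_sdiff_add_card B' B
    rw [Finset.union_comm] at h
    have h' := Finset.card_le_card hsub
    exact_mod_cast h.trans_le h'
  rw [← norm_mul, sub_mul, one_mul, hsum]
  have h3 : expSum B χ - ∑ b ∈ B', χ b = ∑ x ∈ B \ B', χ x - ∑ x ∈ B' \ B, χ x :=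
    Finset.sum_sdiff_sub_sum_sdiff.symm
  rw [h3]
  have := norm_sub_le (∑ x ∈ B \ B', χ x) (∑ x ∈ B' \ B, χ x)
  have := hb (B \ B')
  have := hb (B' \ B)
  linarith

lemma expSum_sq (B : Finset α) (χ : AddChar α ℂ) :
    expSum B χ * expSum B χ = ∑ p ∈ B ×ˢ B, χ (p.1 + p.2) := by
  rw [expSum, Finset.sum_mul_sum, Finset.sum_product]
  simp [AddChar.map_add_eq_mul]

lemma conj_expSum [Finite α] (B : Finset α) (χ : AddChar α ℂ) :
    (starRingEnd ℂ) (expSum B χ) = ∑ b ∈ B, χ (-b) := by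
  simp [expSum, AddChar.map_neg_eq_conj]

lemma norm_expSum_pow_four [Finite α] (B : Finset α) (χ : AddChar α ℂ) (x : α) :
    ((‖expSum B χ‖ ^ 4 : ℝ) : ℂ) * χ x =
      ∑ q ∈ (B ×ˢ B) ×ˢ B ×ˢ B, χ (q.1.1 + q.1.2 - (q.2.1 + q.2.2) + x) := by
  have h1 : ((‖expSum B χ‖ ^ 4 : ℝ) : ℂ) = (expSum B χ * expSum B χ) *
      (starRingEnd ℂ) (expSum B χ * expSum B χ) := by
    rw [Complex.mul_conj, Complex.normSq_eq_norm_sq, norm_mul]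
    push_cast
    ring
  rw [h1, expSum_sq, map_sum, Finset.sum_mul_sum, Finset.sum_mul]
  conv_rhs => rw [Finset.sum_product]
  refine Finset.sum_congr rfl fun p _ => ?_
  rw [Finset.sum_mul]
  refine Finset.sum_congr rfl fun q _ => ?_
  rw [← AddChar.map_neg_eq_conj, ← AddChar.map_add_eq_mul, ← AddChar.map_add_eq_mul,
    sub_eq_add_neg]

lemma norm_expSum_sq [Finite α] (B : Finset α) (χ : AddChar α ℂ) :
    ((‖expSum B χ‖ ^ 2 : ℝ) : ℂ) = ∑ q ∈ B ×ˢ B, χ (q.1 - q.2) := by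
  have h1 : ((‖expSum B χ‖ ^ 2 : ℝ) : ℂ) = expSum B χ * (starRingEnd ℂ) (expSum B χ) := by
    rw [Complex.mul_conj, Complex.normSq_eq_norm_sq]
  rw [h1, conj_expSum, expSum, Finset.sum_mul_sum, Finset.sum_product]
  simp [sub_eq_add_neg, AddChar.map_add_eq_mul]

lemma sum_addChar_sum [Fintype α] [Fintype (AddChar α ℂ)] [DecidableEq α] {κ : Type*}
    (s : Finset κ) (g : κ → α) :
    ∑ χ : AddChar α ℂ, ∑ q ∈ s, χ (g q) =
      Fintype.card α * (s.filter fun q => g q = 0).card := by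
  rw [Finset.sum_comm]
  have : ∀ q, ∑ χ : AddChar α ℂ, χ (g q) = if g q = 0 then (Fintype.card α : ℂ) else 0 := by
    intro q
    convert AddChar.sum_apply_eq_ite (g q)
  simp only [this]
  rw [← Finset.sum_filter, Finset.sum_const, nsmul_eq_mul, mul_comm]

theorem mem_of_large_spectrum [Finite α] [DecidableEq α] (B : Finset α) (hne : B.Nonempty) {K : ℕ} {η : ℝ}
    (hK : (B + B).card ≤ K * B.card) (hη : 3 * K * η ^ 2 < 1) {x : α}
    (hx : ∀ χ : AddChar α ℂ, η * B.card ≤ ‖expSum B χ‖ → ‖1 - χ x‖ ≤ 1) :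
    x ∈ 2 • B - 2 • B := by
  classical
  have := Fintype.ofFinite α
  have := Fintype.ofFinite (AddChar α ℂ)
  by_contra hcon
  have hS : ∀ y, ((∑ χ : AddChar α ℂ, ‖expSum B χ‖ ^ 4 * (χ y).re : ℝ)) =
      Fintype.card α * (((B ×ˢ B) ×ˢ B ×ˢ B).filter
        fun q => q.1.1 + q.1.2 - (q.2.1 + q.2.2) + y = 0).card := by
    intro y
    have h := sum_addChar_sum ((B ×ˢ B) ×ˢ B ×ˢ B)
      (fun q => q.1.1 + q.1.2 - (q.2.1 + q.2.2) + y)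
    simp_rw [← norm_expSum_pow_four] at h
    have h2 := congrArg Complex.re h
    rw [Complex.re_sum] at h2
    simp_rw [Complex.re_ofReal_mul] at h2
    rw [h2, ← Nat.cast_mul, Complex.natCast_re, Nat.cast_mul]
  have h2S : (∑ χ : AddChar α ℂ, ‖expSum B χ‖ ^ 2 : ℝ) = Fintype.card α * B.card := by
    have h := sum_addChar_sum (B ×ˢ B) (fun q => q.1 - q.2)
    simp_rw [← norm_expSum_sq] at h
    have h3 : ((B ×ˢ B).filter fun q => q.1 - q.2 = 0).card = B.card := by
      have : ((B ×ˢ B).filter fun q => q.1 - q.2 = 0) = B.diag := by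
        ext ⟨a, b⟩
        simp only [Finset.mem_filter, Finset.mem_product, sub_eq_zero, Finset.mem_diag]
        constructor
        · rintro ⟨⟨h1, _⟩, h2⟩; exact ⟨h1, h2⟩
        · rintro ⟨h1, rfl⟩; exact ⟨⟨h1, h1⟩, rfl⟩
      rw [this, Finset.diag_card]
    rw [h3] at h
    exact_mod_cast h
  have hx0 : (∑ χ : AddChar α ℂ, ‖expSum B χ‖ ^ 4 * (χ x).re : ℝ) = 0 := by
    rw [hS x]
    have : (((B ×ˢ B) ×ˢ B ×ˢ B).filter
        fun q => q.1.1 + q.1.2 - (q.2.1 + q.2.2) + x = 0) = ∅ := by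
      refine Finset.filter_eq_empty_iff.2 ?_
      rintro ⟨⟨a, b⟩, c, e⟩ hq h
      simp only [Finset.mem_product] at hq
      apply hcon
      have : x = (c + e) - (a + b) := by
        have h' : a + b - (c + e) + x = 0 := h
        rw [add_comm, ← eq_neg_iff_add_eq_zero] at h'
        rw [h', neg_sub]
      rw [this, two_nsmul]
      exact Finset.sub_mem_sub (Finset.add_mem_add hq.2.1 hq.2.2)
        (Finset.add_mem_add hq.1.1 hq.1.2)
    rw [this]; simp
  have hE : (B.card : ℝ) ^ 3 ≤ K * (((B ×ˢ B) ×ˢ B ×ˢ B).filter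
        fun q => q.1.1 + q.1.2 - (q.2.1 + q.2.2) + 0 = 0).card := by
    have h1 := Finset.le_card_add_mul_addEnergy B B
    rw [Finset.addEnergy_eq_card_filter] at h1
    simp_rw [add_zero, sub_eq_zero]
    set e := (((B ×ˢ B) ×ˢ B ×ˢ B).filter fun q => q.1.1 + q.1.2 = q.2.1 + q.2.2).card with he
    have h2 : B.card * B.card ^ 3 ≤ B.card * (K * e) := by
      calc B.card * B.card ^ 3 = B.card ^ 2 * B.card ^ 2 := by ring
        _ ≤ _ := h1
        _ ≤ K * B.card * e := Nat.mul_le_mul_right _ hK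
        _ = _ := by ring
    exact_mod_cast Nat.le_of_mul_le_mul_left h2 hne.card_pos
  have hpt : ∀ χ : AddChar α ℂ, ‖expSum B χ‖ ^ 4 / 2 -
      3 / 2 * (η ^ 2 * B.card ^ 2 * ‖expSum B χ‖ ^ 2) ≤ ‖expSum B χ‖ ^ 4 * (χ x).re := by
    intro χ
    have hn : ‖χ x‖ = 1 := AddChar.norm_apply χ x
    set f := ‖expSum B χ‖ with hf
    have hf0 : 0 ≤ f := norm_nonneg _
    by_cases hχ : η * B.card ≤ f
    · have h1 := hx χ hχ
      have h2 : (1 : ℝ) / 2 ≤ (χ x).re := by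
        have h3 : ‖1 - χ x‖ ^ 2 ≤ 1 := pow_le_one₀ (norm_nonneg _) h1
        rw [← Complex.normSq_eq_norm_sq, Complex.normSq_sub, Complex.normSq_one,
          Complex.normSq_eq_norm_sq, hn] at h3
        simp at h3
        linarith
      have h4 : f ^ 4 * (1 / 2) ≤ f ^ 4 * (χ x).re :=
        mul_le_mul_of_nonneg_left h2 (by positivity)
      have h5 : 0 ≤ η ^ 2 * B.card ^ 2 * f ^ 2 := by positivity
      linarith
    · push Not at hχ
      have h2 : -1 ≤ (χ x).re := by
        have := Complex.abs_re_le_norm (χ x)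
        rw [hn] at this
        exact (abs_le.1 this).1
      have h4 : f ^ 4 * (-1) ≤ f ^ 4 * (χ x).re :=
        mul_le_mul_of_nonneg_left h2 (by positivity)
      have h5 : f ^ 2 ≤ (η * B.card) ^ 2 := pow_le_pow_left₀ hf0 hχ.le 2
      have h6 : f ^ 2 * f ^ 2 ≤ (η * B.card) ^ 2 * f ^ 2 :=
        mul_le_mul_of_nonneg_right h5 (by positivity)
      nlinarith
  have hsum := Finset.sum_le_sum fun χ (_ : χ ∈ Finset.univ) => hpt χ
  rw [hx0, Finset.sum_sub_distrib, ← Finset.mul_sum, ← Finset.mul_sum, h2S] at hsum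
  have h4 : (∑ χ : AddChar α ℂ, ‖expSum B χ‖ ^ 4 / 2 : ℝ) =
      (∑ χ : AddChar α ℂ, ‖expSum B χ‖ ^ 4 * (χ (0 : α)).re) / 2 := by
    rw [Finset.sum_div]
    simp
  rw [h4, hS 0] at hsum
  set e : ℝ := ((((B ×ˢ B) ×ˢ B ×ˢ B).filter
        fun q => q.1.1 + q.1.2 - (q.2.1 + q.2.2) + 0 = 0).card : ℝ) with he
  have hcpos : (0 : ℝ) < Fintype.card α := by exact_mod_cast Fintype.card_pos
  have hb : (0 : ℝ) < B.card := by exact_mod_cast hne.card_pos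
  have h5 : (Fintype.card α : ℝ) * (e - 3 * η ^ 2 * B.card ^ 3) ≤ 0 := by nlinarith
  have h6 : e ≤ 3 * η ^ 2 * B.card ^ 3 := by
    by_contra! hlt
    have := mul_pos hcpos (sub_pos.2 hlt)
    linarith
  have hb3 : (0 : ℝ) < (B.card : ℝ) ^ 3 := by positivity
  have h7 : (B.card : ℝ) ^ 3 ≤ 3 * K * η ^ 2 * B.card ^ 3 := by
    have := mul_le_mul_of_nonneg_left h6 (Nat.cast_nonneg (α := ℝ) K)
    linarith
  nlinarith

end Bogolyubov

section DyadicGenerators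

variable {α : Type*} [AddCommGroup α]

/-- The distance from `χ x` to `1`. -/
noncomputable def charDist (χ : AddChar α ℂ) (x : α) : ℝ := ‖1 - χ x‖

lemma charDist_nonneg (χ : AddChar α ℂ) (x : α) : 0 ≤ charDist χ x := norm_nonneg _

lemma charDist_zero (χ : AddChar α ℂ) : charDist χ 0 = 0 := by simp [charDist]

lemma charDist_add_le [Finite α] (χ : AddChar α ℂ) (x y : α) :
    charDist χ (x + y) ≤ charDist χ x + charDist χ y := by
  unfold charDist
  have h : 1 - χ (x + y) = (1 - χ x) + χ x * (1 - χ y) := by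
    rw [AddChar.map_add_eq_mul]; ring
  rw [h]
  refine (norm_add_le _ _).trans ?_
  rw [norm_mul, AddChar.norm_apply, one_mul]

lemma charDist_neg [Finite α] (χ : AddChar α ℂ) (x : α) : charDist χ (-x) = charDist χ x := by
  unfold charDist
  have h : 1 - χ (-x) = -(χ (-x) * (1 - χ x)) := by
    have : χ (-x) * χ x = 1 := by rw [← AddChar.map_add_eq_mul]; simp
    rw [mul_sub, this]; ring
  rw [h, norm_neg, norm_mul, AddChar.norm_apply, one_mul]

lemma charDist_sub_le [Finite α] (χ : AddChar α ℂ) (x y : α) :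
    charDist χ (x - y) ≤ charDist χ x + charDist χ y := by
  rw [sub_eq_add_neg, ← charDist_neg χ y]
  exact charDist_add_le χ x (-y)

lemma le_charDist_two_nsmul (χ : AddChar α ℂ) (x : α) :
    (2 - charDist χ x) * charDist χ x ≤ charDist χ (2 • x) := by
  unfold charDist
  have h : 1 - χ (2 • x) = (1 + χ x) * (1 - χ x) := by
    rw [two_nsmul, AddChar.map_add_eq_mul]; ring
  rw [h, norm_mul]
  refine mul_le_mul_of_nonneg_right ?_ (norm_nonneg _)
  have h2 : (2 : ℂ) = (1 + χ x) + (1 - χ x) := by ring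
  have h3 := norm_add_le (1 + χ x) (1 - χ x)
  rw [← h2] at h3
  simp only [Complex.norm_ofNat] at h3
  linarith

lemma charDist_pow_le {χ : AddChar α ℂ} {x : α} {a : ℕ} {δ : ℝ}
    (h : ∀ i < a, charDist χ (2 ^ i • x) ≤ 1) (ha : charDist χ (2 ^ a • x) ≤ δ) :
    ∀ i ≤ a, charDist χ (2 ^ i • x) ≤ δ := by
  intro i hi
  induction hi using Nat.decreasingInduction with
  | self => exact ha
  | of_succ i hi ih =>
    have h1 := le_charDist_two_nsmul χ (2 ^ i • x)
    rw [← mul_nsmul', ← pow_succ'] at h1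
    have h2 := h i hi
    have h3 := charDist_nonneg χ (2 ^ i • x)
    nlinarith

lemma charDist_nsmul_le [Finite α] (χ : AddChar α ℂ) (a : ℕ) : ∀ (u : α),
    (∀ i ≤ a, charDist χ (2 ^ i • u) ≤ 1 / 8) → ∀ m ≤ 2 ^ a,
    charDist χ (m • u) ≤ 3 / 8 - 2 * charDist χ u := by
  induction a with
  | zero =>
    intro u hu m hm
    have h1 := hu 0 le_rfl
    simp only [pow_zero, one_nsmul] at h1 hm
    interval_cases m
    · rw [zero_nsmul, charDist_zero]; linarith
    · rw [one_nsmul]; linarith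
  | succ a ih =>
    intro u hu m hm
    have h1 := ih (2 • u) (fun i hi => by
      have := hu (i + 1) (by omega)
      rwa [pow_succ, mul_nsmul'] at this) (m / 2) (by rw [pow_succ] at hm; omega)
    have h2 : charDist χ u ≤ 1 / 8 := by simpa using hu 0 (by omega)
    have h3 := le_charDist_two_nsmul χ u
    have h4 := charDist_nonneg χ u
    have h5 : charDist χ ((m % 2) • u) ≤ charDist χ u := by
      rcases Nat.mod_two_eq_zero_or_one m with h | h
      · rw [h, zero_nsmul, charDist_zero]; exact h4
      · rw [h, one_nsmul]
    have h6 : m • u = (m / 2) • (2 • u) + (m % 2) • u := by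
      rw [← mul_nsmul', ← add_nsmul]
      congr 1
      omega
    rw [h6]
    have h7 := charDist_add_le χ ((m / 2) • (2 • u)) ((m % 2) • u)
    nlinarith

lemma exists_pow_charDist_gt {χ : AddChar α ℂ} {x : α} (hx : 0 < charDist χ x) :
    ∃ i : ℕ, 1 / 8 < charDist χ (2 ^ i • x) := by
  by_contra! hcon
  have h : ∀ i : ℕ, (3 / 2 : ℝ) ^ i * charDist χ x ≤ charDist χ (2 ^ i • x) := by
    intro i
    induction i with
    | zero => simp
    | succ i ih =>
      have h1 := le_charDist_two_nsmul χ (2 ^ i • x)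
      rw [← mul_nsmul', ← pow_succ'] at h1
      have h2 := hcon i
      have h3 := charDist_nonneg χ (2 ^ i • x)
      rw [pow_succ]
      nlinarith
  obtain ⟨i, hi⟩ := pow_unbounded_of_one_lt (1 / charDist χ x) (show (1 : ℝ) < 3 / 2 by norm_num)
  have h1 := h i
  have h2 := hcon i
  rw [div_lt_iff₀ hx] at hi
  linarith

lemma exists_separated_subset {β : Type*} [Finite β] (P : β → Prop) (T : β → β → Prop)
    (hT : ∀ x y, T x y → T y x) (hrefl : ∀ x, T x x) :
    ∃ W : Finset β, (∀ v ∈ W, P v) ∧ (∀ v ∈ W, ∀ w ∈ W, T v w → v = w) ∧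
      ∀ x, P x → ∃ v ∈ W, T x v := by
  classical
  have := Fintype.ofFinite β
  let F : Finset (Finset β) := Finset.univ.filter fun W =>
    (∀ v ∈ W, P v) ∧ (∀ v ∈ W, ∀ w ∈ W, T v w → v = w)
  obtain ⟨W, hW, hmax⟩ := F.exists_max_image Finset.card ⟨∅, by simp [F]⟩
  simp only [F, Finset.mem_filter, Finset.mem_univ, true_and] at hW hmax
  refine ⟨W, hW.1, hW.2, fun x hx => ?_⟩
  by_contra! hcon
  have hxW : x ∉ W := fun h => hcon x h (hrefl x)
  have := hmax (insert x W) ⟨?_, ?_⟩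
  · rw [Finset.card_insert_of_notMem hxW] at this
    omega
  · intro v hv
    rcases Finset.mem_insert.1 hv with rfl | hv
    · exact hx
    · exact hW.1 v hv
  · intro v hv w hw hvw
    rcases Finset.mem_insert.1 hv with rfl | hv' <;> rcases Finset.mem_insert.1 hw with rfl | hw'
    · rfl
    · exact absurd hvw (hcon w hw')
    · exact absurd (hT _ _ hvw) (hcon v hv')
    · exact hW.2 v hv' w hw' hvw

/-- The annihilator of a set of characters. -/
def charAnnihilator (Γ : Set (AddChar α ℂ)) : AddSubgroup α where
  carrier := {x | ∀ χ ∈ Γ, χ x = 1}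
  zero_mem' χ _ := AddChar.map_zero_eq_one χ
  add_mem' ha hb χ hχ := by rw [AddChar.map_add_eq_mul, ha χ hχ, hb χ hχ, one_mul]
  neg_mem' ha χ hχ := by rw [AddChar.map_neg_eq_inv, ha χ hχ, inv_one]

theorem exists_dyadic_generators [Finite α] [DecidableEq α] (Γ : Set (AddChar α ℂ)) (A S : Finset α)
    (hA : ∀ a ∈ A, ∀ χ ∈ Γ, charDist χ a ≤ 1 / 64)
    (hS : ∀ x, (∀ χ ∈ Γ, charDist χ x ≤ 1) → x ∈ S) :
    ∃ (N : ℕ) (H : AddSubgroup α) (u : Fin N → α) (L : Fin N → ℕ),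
      N * A.card ≤ S.card ∧ (∀ i, 1 ≤ L i) ∧ (∀ h ∈ H, h ∈ S) ∧
      (∀ i, ∀ m : ℤ, |m| ≤ L i → m • u i ∈ S) ∧
      ∀ a ∈ A, ∃ m ∈ intBox L, a - ∑ i, m i • u i ∈ H := by
  classical
  have := Fintype.ofFinite α
  set B : ℕ → α → Prop := fun a x => ∀ i ≤ a, ∀ χ ∈ Γ, charDist χ (2 ^ i • x) ≤ 1 / 8 with hB
  set H := charAnnihilator Γ with hH
  have hstar : ∃ s : ℕ, ∀ x, B s x → x ∈ H := by
    have : ∀ x, ∃ s : ℕ, B s x → x ∈ H := by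
      intro x
      by_cases hx : x ∈ H
      · exact ⟨0, fun _ => hx⟩
      · have hx' : ¬ ∀ χ ∈ Γ, χ x = 1 := hx
        push Not at hx'
        obtain ⟨χ, hχ, hχx⟩ := hx'
        have hpos : 0 < charDist χ x := by
          rw [charDist, norm_pos_iff, sub_ne_zero]; exact hχx.symm
        obtain ⟨i, hi⟩ := exists_pow_charDist_gt hpos
        exact ⟨i, fun h => absurd (h i le_rfl χ hχ) (not_le.2 hi)⟩
    choose f hf using this
    refine ⟨Finset.univ.sup f, fun x hx => hf x fun i hi => hx i (hi.trans ?_)⟩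
    exact Finset.le_sup (f := f) (Finset.mem_univ x)
  obtain ⟨s, hs⟩ := hstar
  obtain ⟨W, hWP, hWsep, hWcov⟩ := exists_separated_subset (β := α)
    (fun x => ∀ χ ∈ Γ, charDist χ x ≤ 1 / 8)
    (fun x y => ∀ χ ∈ Γ, charDist χ (x - y) ≤ 1 / 32)
    (fun x y h χ hχ => by rw [← neg_sub, charDist_neg]; exact h χ hχ)
    (fun x χ _ => by rw [sub_self, charDist_zero]; norm_num)
  have hwit : ∀ v, ∃ (a : ℕ) (u : α), (v ∈ W → a ≤ s ∧ B a u ∧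
      (∀ χ ∈ Γ, charDist χ (2 ^ a • u - v) ≤ 1 / 32) ∧
      ∀ b ≤ s, ∀ w, B b w → (∀ χ ∈ Γ, charDist χ (2 ^ b • w - v) ≤ 1 / 32) → b ≤ a) := by
    intro v
    by_cases hv : v ∈ W
    · let Q : ℕ → Prop := fun a => ∃ u, B a u ∧ ∀ χ ∈ Γ, charDist χ (2 ^ a • u - v) ≤ 1 / 32
      have hQ0 : Q 0 := ⟨v, fun i hi χ hχ => by
        obtain rfl : i = 0 := by omega
        simpa using hWP v hv χ hχ, fun χ _ => by simp [charDist_zero]⟩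
      obtain ⟨u, hu1, hu2⟩ := Nat.findGreatest_spec (P := Q) (Nat.zero_le s) hQ0
      exact ⟨Nat.findGreatest Q s, u, fun _ => ⟨Nat.findGreatest_le s, hu1, hu2,
        fun b hb w hw1 hw2 => Nat.le_findGreatest hb ⟨w, hw1, hw2⟩⟩⟩
    · exact ⟨0, 0, fun h => absurd h hv⟩
  choose e u hu using hwit
  have hrep : ∀ a ≤ s, ∀ x, B a x → ∃ m : α → ℕ, (∀ v ∈ W, m v * 2 ^ a ≤ 2 ^ (e v + 1)) ∧
      x - ∑ v ∈ W, m v • u v ∈ H := by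
    intro a ha
    induction ha using Nat.decreasingInduction with
    | self => exact fun x hx => ⟨0, by simp, by simpa using hs x hx⟩
    | of_succ a has ih =>
      intro g hg
      obtain ⟨v, hv, hgv⟩ := hWcov (2 ^ a • g) (fun χ hχ => hg a le_rfl χ hχ)
      obtain ⟨he, hBu, hvu, hmax⟩ := hu v hv
      have hae : a ≤ e v := hmax a has.le g hg hgv
      set y := 2 ^ (e v - a) • u v with hy
      have hyi : ∀ i ≤ a, ∀ χ ∈ Γ, charDist χ (2 ^ i • y) ≤ 1 / 8 := by
        intro i hi χ hχ
        rw [hy, ← mul_nsmul', ← pow_add]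
        exact hBu _ (by omega) χ hχ
      have hya : 2 ^ a • y = 2 ^ e v • u v := by
        rw [hy, ← mul_nsmul', ← pow_add]
        congr 2; omega
      have hz : ∀ i ≤ a, ∀ χ ∈ Γ, charDist χ (2 ^ i • (g - y)) ≤ 1 / 16 := by
        intro i hi χ hχ
        refine charDist_pow_le (a := a) (fun i hi => ?_) ?_ i hi
        · rw [nsmul_sub]
          have h1 := charDist_sub_le χ (2 ^ i • g) (2 ^ i • y)
          have h2 := hg i hi.le χ hχ
          have h3 := hyi i hi.le χ hχ
          linarith
        · have h0 : 2 ^ a • (g - y) = (2 ^ a • g - v) - (2 ^ e v • u v - v) := by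
            rw [nsmul_sub, hya]; abel
          rw [h0]
          have h1 := charDist_sub_le χ (2 ^ a • g - v) (2 ^ e v • u v - v)
          have h2 := hgv χ hχ
          have h3 := hvu χ hχ
          linarith
      have hzB : B (a + 1) (g - y) := by
        intro i hi χ hχ
        rcases Nat.lt_or_ge a i with h | h
        · obtain rfl : i = a + 1 := by omega
          rw [pow_succ, mul_comm, mul_nsmul', two_nsmul]
          have h1 := charDist_add_le χ (2 ^ a • (g - y)) (2 ^ a • (g - y))
          have h2 := hz a le_rfl χ hχ
          linarith
        · have := hz i h χ hχ
          linarith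
      obtain ⟨m, hm, hmH⟩ := ih (g - y) hzB
      refine ⟨fun w => m w + if w = v then 2 ^ (e v - a) else 0, fun w hw => ?_, ?_⟩
      · have h1 := hm w hw
        rw [pow_succ, pow_succ, ← mul_assoc] at h1
        have h2 : (if w = v then 2 ^ (e v - a) else 0) * 2 ^ a ≤ 2 ^ e w := by
          split_ifs with h
          · rw [h, ← pow_add]
            exact Nat.pow_le_pow_right (by norm_num) (by omega)
          · simp
        rw [add_mul, pow_succ]
        omega
      · simp only [add_nsmul, Finset.sum_add_distrib, ite_smul, zero_smul, Finset.sum_ite_eq', hv,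
          if_true]
        convert hmH using 1
        rw [hy]; abel
  have hcardW : W.card * A.card ≤ S.card := by
    rw [← Finset.card_product]
    refine Finset.card_le_card_of_injOn (fun p => p.1 + p.2) ?_ ?_
    · rintro ⟨v, a⟩ hp
      simp only [Finset.coe_product, Set.mem_prod, Finset.mem_coe] at hp
      refine hS _ fun χ hχ => ?_
      have h1 := charDist_add_le χ v a
      have h2 := hWP v hp.1 χ hχ
      have h3 := hA a hp.2 χ hχ
      simp only
      linarith
    · rintro ⟨v, a⟩ hp ⟨w, b⟩ hq h
      simp only [Finset.coe_product, Set.mem_prod, Finset.mem_coe] at hp hq h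
      have hvw : v = w := by
        refine hWsep v hp.1 w hq.1 fun χ hχ => ?_
        have h0 : v - w = b - a := by
          rw [sub_eq_sub_iff_add_eq_add, h, add_comm]
        rw [h0]
        have h1 := charDist_sub_le χ b a
        have h2 := hA a hp.2 χ hχ
        have h3 := hA b hq.2 χ hχ
        linarith
      subst hvw
      simpa using h
  let eq := W.equivFin
  refine ⟨W.card, H, fun i => u (eq.symm i), fun i => 2 ^ (e (eq.symm i) + 1), hcardW,
    fun i => Nat.one_le_two_pow, ?_, ?_, ?_⟩
  · intro h hh
    refine hS h fun χ hχ => ?_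
    rw [charDist, hh χ hχ]; simp
  · intro i m hm
    obtain ⟨-, hBu, -, -⟩ := hu (eq.symm i) (eq.symm i).2
    set v : α := ((eq.symm i : W) : α)
    refine hS _ fun χ hχ => ?_
    have hn : charDist χ (m • u v) = charDist χ (m.natAbs • u v) := by
      rcases Int.natAbs_eq m with h | h
      · conv_lhs => rw [h, natCast_zsmul]
      · conv_lhs => rw [h, neg_smul, natCast_zsmul, charDist_neg]
    rw [hn]
    have hm' : m.natAbs ≤ 2 ^ e v + 2 ^ e v := by
      have : (m.natAbs : ℤ) ≤ (2 ^ (e v + 1) : ℕ) := by rw [← Int.abs_eq_natAbs]; exact hm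
      have h2 : m.natAbs ≤ 2 ^ (e v + 1) := by exact_mod_cast this
      rw [pow_succ] at h2; omega
    have hsplit : m.natAbs • u v = (min m.natAbs (2 ^ e v)) • u v +
        (m.natAbs - 2 ^ e v) • u v := by
      rw [← add_nsmul]; congr 1; omega
    rw [hsplit]
    have h1 := charDist_add_le χ ((min m.natAbs (2 ^ e v)) • u v)
      ((m.natAbs - 2 ^ e v) • u v)
    have h2 := charDist_nsmul_le χ (e v) (u v) (fun i hi => hBu i hi χ hχ)
      (min m.natAbs (2 ^ e v)) (min_le_right _ _)
    have h3 := charDist_nsmul_le χ (e v) (u v) (fun i hi => hBu i hi χ hχ)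
      (m.natAbs - 2 ^ e v) (by omega)
    have h4 := charDist_nonneg χ (u v)
    linarith
  · intro a ha
    obtain ⟨m, hm, hmH⟩ := hrep 0 (Nat.zero_le _) a (fun i hi χ hχ => by
      obtain rfl : i = 0 := by omega
      have := hA a ha χ hχ
      simp only [pow_zero, one_nsmul]
      linarith)
    refine ⟨fun i => m (eq.symm i), fun i => ?_, ?_⟩
    · have := hm (eq.symm i) (eq.symm i).2
      rw [pow_zero, mul_one] at this
      rw [Nat.abs_cast]
      exact_mod_cast this
    · convert hmH using 2
      rw [← Finset.sum_coe_sort W, ← Equiv.sum_comp eq.symm]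
      simp

end DyadicGenerators

section FiniteModels

/-- The generators found in a finite group, for a set `A` which barely grows at scale `n`. -/
lemma exists_generators_of_finite {α : Type*} [AddCommGroup α] [Finite α] [DecidableEq α]
    (A : Finset α) (h0 : 0 ∈ A) (d n : ℕ)
    (h2 : (n • A + n • A).card ≤ 16 ^ d * (n • A).card)
    (hstep : 256 * 4 ^ d * (n • A + A).card ≤ (256 * 4 ^ d + 1) * (n • A).card) :
    ∃ (N : ℕ) (H : AddSubgroup α) (u : Fin N → α) (L : Fin N → ℕ),
      N * A.card ≤ (2 • (n • A) - 2 • (n • A)).card ∧ (∀ i, 1 ≤ L i) ∧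
      (∀ h ∈ H, h ∈ 2 • (n • A) - 2 • (n • A)) ∧
      (∀ i, ∀ m : ℤ, |m| ≤ L i → m • u i ∈ 2 • (n • A) - 2 • (n • A)) ∧
      ∀ a ∈ A, ∃ m ∈ intBox L, a - ∑ i, m i • u i ∈ H := by
  set B := n • A with hB
  have hne : B.Nonempty := Finset.Nonempty.nsmul ⟨0, h0⟩
  have hb : (0 : ℝ) < B.card := by exact_mod_cast hne.card_pos
  set η : ℝ := 1 / (2 * 4 ^ d) with hη
  have hη0 : 0 < η := by positivity
  refine exists_dyadic_generators {χ | η * B.card ≤ ‖expSum B χ‖} A _ ?_ ?_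
  · intro a ha χ hχ
    have h1 := norm_sub_mul_norm_expSum_le B A h0 ha χ
    have h3 : (256 : ℝ) * 4 ^ d * ((B + A).card - B.card) ≤ B.card := by
      have : (256 : ℝ) * 4 ^ d * (B + A).card ≤ (256 * 4 ^ d + 1) * B.card := by
        exact_mod_cast hstep
      linarith
    have h4 : charDist χ a * (η * B.card) ≤ 2 * ((B + A).card - B.card) :=
      (mul_le_mul_of_nonneg_left hχ (charDist_nonneg χ a)).trans h1
    have h5 : η * (2 * 4 ^ d) = 1 := by
      rw [hη]; field_simp
    have h6 : (charDist χ a * (η * B.card)) * (2 * 4 ^ d) = charDist χ a * B.card := by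
      calc _ = charDist χ a * B.card * (η * (2 * 4 ^ d)) := by ring
        _ = _ := by rw [h5, mul_one]
    have h7 := mul_le_mul_of_nonneg_right h4 (show (0 : ℝ) ≤ 2 * 4 ^ d by positivity)
    rw [h6] at h7
    have h8 : charDist χ a * B.card ≤ 1 / 64 * B.card := by linarith
    exact le_of_mul_le_mul_right h8 hb
  · intro x hx
    refine mem_of_large_spectrum B hne (K := 16 ^ d) (η := η) h2 ?_ hx
    have h5 : η * (2 * 4 ^ d) = 1 := by
      rw [hη]; field_simp
    have h6 : (4 : ℝ) ^ d * 4 ^ d = 16 ^ d := by rw [← mul_pow]; norm_num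
    have h7 : 4 * ((16 : ℝ) ^ d * η ^ 2) = 1 := by
      rw [← h6]
      calc _ = (η * (2 * 4 ^ d)) ^ 2 := by ring
        _ = 1 := by rw [h5]; norm_num
    push_cast
    linarith

variable {G : Type*} [AddCommGroup G]

lemma exists_zmod_apply_ne_zero [AddGroup.FG G] {x : G} (hx : x ≠ 0) :
    ∃ (M : ℕ) (_ : NeZero M) (ψ : G →+ ZMod M), ψ x ≠ 0 := by
  obtain ⟨n, ι, _, p, hp, e, ⟨f⟩⟩ := AddCommGroup.equiv_free_prod_directSum_zmod G
  have hfx : f x ≠ 0 := by simpa using hx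
  by_cases h1 : (f x).1 = 0
  · have h2 : (f x).2 ≠ 0 := fun h => hfx (Prod.ext h1 h)
    have h3 : ∃ i, (f x).2 i ≠ 0 := by
      by_contra! h
      exact h2 (DFinsupp.ext h)
    obtain ⟨i, hi⟩ := h3
    exact ⟨p i ^ e i, ⟨pow_ne_zero _ (hp i).ne_zero⟩,
      ((DFinsupp.evalAddMonoidHom i).comp (AddMonoidHom.snd _ _)).comp f.toAddMonoidHom, hi⟩
  · have h3 : ∃ i, (f x).1 i ≠ 0 := by
      by_contra! h
      exact h1 (Finsupp.ext h)
    obtain ⟨i, hi⟩ := h3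
    refine ⟨((f x).1 i).natAbs + 1, ⟨by omega⟩, ((Int.castAddHom _).comp
      ((Finsupp.applyAddHom i).comp (AddMonoidHom.fst _ _))).comp f.toAddMonoidHom, ?_⟩
    change (((f x).1 i : ℤ) : ZMod (((f x).1 i).natAbs + 1)) ≠ 0
    rw [Ne, ZMod.intCast_zmod_eq_zero_iff_dvd]
    intro hdvd
    have := Int.natAbs_dvd_natAbs.2 hdvd
    have := Nat.le_of_dvd (Int.natAbs_pos.2 hi) this
    rw [Int.natAbs_natCast] at this
    omega

lemma exists_finite_model {G : Type} [AddCommGroup G] [AddGroup.FG G] (D : Finset G) :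
    ∃ (α : Type) (_ : AddCommGroup α) (_ : Finite α) (ψ : G →+ α), Set.InjOn ψ D := by
  classical
  choose M hM ψ hψ using fun x : {x : G // x ≠ 0} => exists_zmod_apply_ne_zero x.2
  let J := {x : {x : G // x ≠ 0} // x.1 ∈ D - D}
  have hJ : Finite J := by
    refine Finite.of_injective (β := ((D - D : Finset G) : Set G)) (fun x => ⟨x.1.1, x.2⟩) ?_
    intro x y hxy
    have h : x.1.1 = y.1.1 := Subtype.mk.inj hxy
    exact Subtype.ext (Subtype.ext h)
  have hfin : ∀ x : J, Finite (ZMod (M x.1)) := fun x => by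
    have := hM x.1
    infer_instance
  refine ⟨∀ x : J, ZMod (M x.1), inferInstance, inferInstance,
    AddMonoidHom.pi fun x : J => ψ x.1, fun x hx y hy hxy => ?_⟩
  by_contra hne
  refine hψ ⟨x - y, sub_ne_zero.2 hne⟩ ?_
  have h := congrFun hxy ⟨⟨x - y, sub_ne_zero.2 hne⟩, Finset.sub_mem_sub hx hy⟩
  simp only [AddMonoidHom.pi_apply] at h
  rw [map_sub, h, sub_self]

section DiffSet

variable [DecidableEq G]

/-- The iterated difference set `tA - tA`. -/
def iterDiff (A : Finset G) (t : ℕ) : Finset G := t • A - t • A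

lemma zero_mem_iterDiff {A : Finset G} (h0 : 0 ∈ A) (t : ℕ) : 0 ∈ iterDiff A t := by
  have h := Finset.nsmul_mem_nsmul (n := t) h0
  rw [nsmul_zero] at h
  unfold iterDiff
  have h' := Finset.sub_mem_sub h h
  rwa [sub_zero] at h'

lemma iterDiff_mono {A : Finset G} (h0 : 0 ∈ A) {s t : ℕ} (h : s ≤ t) :
    iterDiff A s ⊆ iterDiff A t :=
  Finset.sub_subset_sub (Finset.nsmul_subset_nsmul_right h0 h)
    (Finset.nsmul_subset_nsmul_right h0 h)

lemma neg_mem_iterDiff {A : Finset G} {t : ℕ} {x : G} (h : x ∈ iterDiff A t) :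
    -x ∈ iterDiff A t := by
  obtain ⟨a, ha, b, hb, rfl⟩ := Finset.mem_sub.1 h
  rw [neg_sub]
  exact Finset.sub_mem_sub hb ha

lemma add_mem_iterDiff {A : Finset G} {s t : ℕ} {x y : G} (hx : x ∈ iterDiff A s)
    (hy : y ∈ iterDiff A t) : x + y ∈ iterDiff A (s + t) := by
  obtain ⟨a, ha, b, hb, rfl⟩ := Finset.mem_sub.1 hx
  obtain ⟨a', ha', b', hb', rfl⟩ := Finset.mem_sub.1 hy
  rw [sub_add_sub_comm]
  unfold iterDiff
  rw [add_nsmul]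
  exact Finset.sub_mem_sub (Finset.add_mem_add ha ha') (Finset.add_mem_add hb hb')

lemma sub_mem_iterDiff {A : Finset G} {s t : ℕ} {x y : G} (hx : x ∈ iterDiff A s)
    (hy : y ∈ iterDiff A t) : x - y ∈ iterDiff A (s + t) := by
  rw [sub_eq_add_neg]
  exact add_mem_iterDiff hx (neg_mem_iterDiff hy)

lemma sum_mem_iterDiff {A : Finset G} (h0 : 0 ∈ A) {s : ℕ} {κ : Type*} (I : Finset κ)
    (f : κ → G) (hf : ∀ i ∈ I, f i ∈ iterDiff A s) : ∑ i ∈ I, f i ∈ iterDiff A (I.card * s) := by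
  classical
  induction I using Finset.induction_on with
  | empty => simpa using zero_mem_iterDiff h0 0
  | insert i I hi ih =>
    rw [Finset.sum_insert hi, Finset.card_insert_of_notMem hi, add_comm I.card, add_mul, one_mul]
    exact add_mem_iterDiff (hf i (Finset.mem_insert_self _ _))
      (ih fun k hk => hf k (Finset.mem_insert_of_mem hk))

lemma mem_iterDiff_one {A : Finset G} (h0 : 0 ∈ A) {a : G} (ha : a ∈ A) : a ∈ iterDiff A 1 := by
  unfold iterDiff
  simpa using Finset.sub_mem_sub ha h0

lemma nsmul_subset_iterDiff {A : Finset G} (h0 : 0 ∈ A) (t : ℕ) : t • A ⊆ iterDiff A t := by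
  intro x hx
  have h := Finset.nsmul_mem_nsmul (n := t) h0
  rw [nsmul_zero] at h
  unfold iterDiff
  have h' := Finset.sub_mem_sub hx h
  rwa [sub_zero] at h'

lemma image_iterDiff {β : Type*} [AddCommGroup β] [DecidableEq β] (ψ : G →+ β) (A : Finset G)
    (t : ℕ) : (iterDiff A t).image ψ = iterDiff (A.image ψ) t := by
  unfold iterDiff
  rw [← Finset.image_nsmul]
  ext x
  simp only [Finset.mem_image, Finset.mem_sub]
  constructor
  · rintro ⟨_, ⟨a, ha, b, hb, rfl⟩, rfl⟩
    exact ⟨ψ a, ⟨a, ha, rfl⟩, ψ b, ⟨b, hb, rfl⟩, by simp⟩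
  · rintro ⟨_, ⟨a, ha, rfl⟩, _, ⟨b, hb, rfl⟩, rfl⟩
    exact ⟨a - b, ⟨a, ha, b, hb, rfl⟩, by simp⟩

end DiffSet

/-- The homomorphism from the integer lattice sending the standard basis to `u`. -/
def latticeHom {N : ℕ} (u : Fin N → G) : (Fin N → ℤ) →+ G where
  toFun m := ∑ i, m i • u i
  map_zero' := by simp
  map_add' a b := by simp [add_smul, Finset.sum_add_distrib]

lemma latticeHom_apply {N : ℕ} (u : Fin N → G) (m : Fin N → ℤ) :
    latticeHom u m = ∑ i, m i • u i := rfl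

theorem exists_sandwich_of_fg {G : Type} [AddCommGroup G] [DecidableEq G] [AddGroup.FG G]
    (A : Finset G) (h0 : 0 ∈ A) (d n : ℕ) (hn : 1 ≤ n)
    (h2 : (n • A + n • A).card ≤ 16 ^ d * (n • A).card)
    (hstep : 256 * 4 ^ d * (n • A + A).card ≤ (256 * 4 ^ d + 1) * (n • A).card) :
    ∃ (N : ℕ) (H : AddSubgroup G) (φ : (Fin N → ℤ) →+ G) (L : Fin N → ℕ),
      N * A.card ≤ (2 • (n • A) - 2 • (n • A)).card ∧ (H : Set G).Finite ∧ (∀ i, 1 ≤ L i) ∧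
      (A : Set G) ⊆ cosetProg H φ L ∧ cosetProg H φ L ⊆ iterDiff A (2 * n * (N + 1)) := by
  classical
  set S := iterDiff A (2 * n) with hS
  have hSeq : 2 • (n • A) - 2 • (n • A) = S := by
    rw [hS, iterDiff, ← mul_nsmul']
  set T := 4 * n + 2 * n * S.card + 1 with hT
  obtain ⟨α, _, _, ψ, hψ⟩ := exists_finite_model (iterDiff A T)
  have hinj : ∀ {x y s t}, x ∈ iterDiff A s → y ∈ iterDiff A t → s ≤ T → t ≤ T → ψ x = ψ y →
      x = y := fun hx hy hs ht h =>
    hψ (iterDiff_mono h0 hs hx) (iterDiff_mono h0 ht hy) h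
  set A' := A.image ψ with hA'
  have h0' : (0 : α) ∈ A' := Finset.mem_image.2 ⟨0, h0, map_zero _⟩
  have hcard : ∀ t ≤ T, (t • A').card = (t • A).card := by
    intro t ht
    rw [hA', ← Finset.image_nsmul]
    exact Finset.card_image_of_injOn fun x hx y hy h =>
      hinj (nsmul_subset_iterDiff h0 t hx) (nsmul_subset_iterDiff h0 t hy) ht ht h
  have hS' : 2 • (n • A') - 2 • (n • A') = S.image ψ := by
    rw [hS, image_iterDiff, iterDiff, ← mul_nsmul']
  obtain ⟨N, H', u', L, hN, hL, hH', hu', hAu'⟩ := exists_generators_of_finite A' h0' d n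
    (by rw [← add_nsmul] at h2 ⊢
        rw [hcard _ (by omega), hcard _ (by omega)]; exact h2)
    (by rw [← succ_nsmul] at hstep ⊢
        rw [hcard _ (by omega), hcard _ (by omega)]; exact hstep)
  rw [hS'] at hN hH' hu'
  have hA1 : A'.card = A.card := by simpa using hcard 1 (by omega)
  have hN' : N * A.card ≤ S.card := by
    rw [← hA1]; exact hN.trans Finset.card_image_le
  have hAne : 1 ≤ A.card := Finset.card_pos.2 ⟨0, h0⟩
  have hNS : N ≤ S.card := le_trans (by nlinarith) hN'
  have hnN : 2 * n * N ≤ 2 * n * S.card := Nat.mul_le_mul_left _ hNS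
  have hlift : ∀ x, x ∈ S.image ψ → ∃ z ∈ S, ψ z = x := fun x hx => Finset.mem_image.1 hx
  have hmemS : ∀ {x t}, x ∈ iterDiff A t → t ≤ T → ψ x ∈ S.image ψ → x ∈ S := by
    intro x t hx ht hxS
    obtain ⟨z, hz, hzx⟩ := hlift _ hxS
    rwa [hinj hx hz ht (by omega) hzx.symm]
  choose u hu hψu using fun i => hlift (u' i)
    (by simpa using hu' i 1 (by simpa using hL i))
  let H : AddSubgroup G :=
    { carrier := {x | x ∈ S ∧ ψ x ∈ H'}
      zero_mem' := ⟨zero_mem_iterDiff h0 _, by rw [map_zero]; exact zero_mem _⟩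
      add_mem' := fun {x y} hx hy => by
        have h : ψ (x + y) ∈ H' := by rw [map_add]; exact add_mem hx.2 hy.2
        exact ⟨hmemS (add_mem_iterDiff hx.1 hy.1) (by omega) (hH' _ h), h⟩
      neg_mem' := fun {x} hx =>
        ⟨neg_mem_iterDiff hx.1, by rw [map_neg]; exact neg_mem hx.2⟩ }
  have hmu : ∀ i (m : ℕ), m ≤ L i → (m : ℤ) • u i ∈ S := by
    intro i m
    induction m with
    | zero => intro _; simpa using zero_mem_iterDiff h0 _
    | succ m ih =>
      intro hm
      have h1 := ih (by omega)
      have h2 : ((m + 1 : ℕ) : ℤ) • u i = (m : ℤ) • u i + u i := by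
        push_cast; rw [add_smul, one_smul]
      refine hmemS (t := 2 * n + 2 * n) (by rw [h2]; exact add_mem_iterDiff h1 (hu i))
        (by omega) ?_
      rw [map_zsmul, hψu]
      refine hu' i _ ?_
      rw [Nat.abs_cast]; exact_mod_cast hm
  have hmuz : ∀ i (m : ℤ), |m| ≤ L i → m • u i ∈ S := by
    intro i m hm
    rw [Int.abs_eq_natAbs] at hm
    have h := hmu i m.natAbs (by exact_mod_cast hm)
    rcases Int.natAbs_eq m with h' | h'
    · rw [h']; exact h
    · rw [h', neg_smul]; exact neg_mem_iterDiff h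
  have hsumS : ∀ m ∈ intBox L, latticeHom u m ∈ iterDiff A (N * (2 * n)) := by
    intro m hm
    have := sum_mem_iterDiff h0 Finset.univ (fun i => m i • u i)
      (fun i _ => hmuz i (m i) (hm i))
    simpa [latticeHom_apply] using this
  refine ⟨N, H, latticeHom u, L, by rwa [hSeq],
    (Finset.finite_toSet S).subset fun x hx => hx.1, hL, ?_, ?_⟩
  · intro a ha
    obtain ⟨m, hm, hmH⟩ := hAu' (ψ a) (Finset.mem_image_of_mem _ ha)
    have h1 : ψ (a - latticeHom u m) ∈ H' := by
      rw [map_sub, latticeHom_apply, map_sum]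
      simpa [hψu] using hmH
    refine ⟨m, hm, ⟨hmemS (sub_mem_iterDiff (mem_iterDiff_one h0 ha) (hsumS m hm)) ?_
      (hH' _ h1), h1⟩⟩
    have : N * (2 * n) = 2 * n * N := by ring
    omega
  · rintro g ⟨m, hm, hg⟩
    have h1 := add_mem_iterDiff hg.1 (hsumS m hm)
    rw [sub_add_cancel] at h1
    have h2 : 2 * n + N * (2 * n) = 2 * n * (N + 1) := by ring
    rw [h2] at h1
    exact h1

end FiniteModels

theorem exists_sandwich {G : Type} [AddCommGroup G] [DecidableEq G]
    (A : Finset G) (h0 : 0 ∈ A) (d n : ℕ) (hn : 1 ≤ n)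
    (h2 : (n • A + n • A).card ≤ 16 ^ d * (n • A).card)
    (hstep : 256 * 4 ^ d * (n • A + A).card ≤ (256 * 4 ^ d + 1) * (n • A).card) :
    ∃ (N : ℕ) (H : AddSubgroup G) (φ : (Fin N → ℤ) →+ G) (L : Fin N → ℕ),
      N * A.card ≤ (2 • (n • A) - 2 • (n • A)).card ∧ (H : Set G).Finite ∧ (∀ i, 1 ≤ L i) ∧
      (A : Set G) ⊆ cosetProg H φ L ∧ cosetProg H φ L ⊆ iterDiff A (2 * n * (N + 1)) := by
  classical
  set K := AddSubgroup.closure (A : Set G) with hK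
  have : AddGroup.FG K := AddGroup.closure_finset_fg A
  set f : K →+ G := K.subtype with hf
  have hinj : Function.Injective f := K.subtype_injective
  set A₀ : Finset K := A.preimage f hinj.injOn with hA₀
  have hA : A₀.image f = A := by
    rw [hA₀, Finset.image_preimage]
    refine Finset.filter_true_of_mem fun a ha => ?_
    exact ⟨⟨a, AddSubgroup.subset_closure ha⟩, rfl⟩
  have hcard : ∀ t, (t • A).card = (t • A₀).card := fun t => by
    rw [← hA, ← Finset.image_nsmul, Finset.card_image_of_injective _ hinj]
  have hcardD : ∀ t, (iterDiff A t).card = (iterDiff A₀ t).card := fun t => by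
    rw [← hA, ← image_iterDiff, Finset.card_image_of_injective _ hinj]
  have h00 : (0 : K) ∈ A₀ := by
    rw [hA₀, Finset.mem_preimage]; exact h0
  rw [← add_nsmul, hcard, hcard] at h2
  rw [← succ_nsmul, hcard, hcard] at hstep
  obtain ⟨N, H, φ, L, hN, hH, hL, hAφ, hφA⟩ := exists_sandwich_of_fg A₀ h00 d n hn
    (by rw [← add_nsmul]; exact h2) (by rw [← succ_nsmul]; exact hstep)
  have hA1 : A₀.card = A.card := by simpa using (hcard 1).symm
  have hD := hcardD (2 * n)
  unfold iterDiff at hD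
  rw [mul_nsmul', mul_nsmul'] at hD
  refine ⟨N, H.map f, f.comp φ, L, by rw [hD, ← hA1]; exact hN, ?_, hL, ?_, ?_⟩
  · rw [AddSubgroup.coe_map]
    exact hH.image f
  · intro a ha
    rw [← hA] at ha
    obtain ⟨x, hx, rfl⟩ := Finset.mem_image.1 ha
    obtain ⟨m, hm, hxm⟩ := hAφ hx
    exact ⟨m, hm, x - φ m, hxm, by simp⟩
  · rintro g ⟨m, hm, x, hx, hxg⟩
    have h : x + φ m ∈ cosetProg H φ L := ⟨m, hm, by simpa using hx⟩
    have h' := Finset.mem_image_of_mem f (hφA h)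
    rw [image_iterDiff, hA, map_add, hxg] at h'
    simpa using h'

/-- Passing to the scale at which the growth of `f` is at most polynomial of degree `d`. -/
lemma exists_polynomial_growth_scale {f : ℕ → ℕ} (hf : Monotone f) (d : ℕ) {k T : ℕ} (hk : 1 ≤ k)
    (hT : T * f k ≤ k ^ d * f 1) :
    ∃ m q, 1 ≤ m ∧ 1 ≤ q ∧ m * q ≤ k ∧ k ≤ m * (q + 1) ∧
      (∀ j, 1 ≤ j → j ≤ q → f (m * j) ≤ j ^ d * f m) ∧ T * f (m * q) ≤ (2 * q) ^ d * f m := by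
  classical
  set m := Nat.findGreatest (fun j => j ^ d * f 1 ≤ f j) k with hm
  have hm1 : 1 ≤ m := Nat.le_findGreatest hk (by simp)
  have hmk : m ≤ k := Nat.findGreatest_le k
  have hmP : m ^ d * f 1 ≤ f m :=
    Nat.findGreatest_spec (P := fun j => j ^ d * f 1 ≤ f j) hk (by simp)
  have hgr : ∀ j, m ≤ j → j ≤ k → f j * m ^ d ≤ j ^ d * f m := by
    intro j hmj hjk
    rcases hmj.eq_or_lt with rfl | hlt
    · exact (mul_comm _ _).le
    · have h := Nat.findGreatest_is_greatest hlt hjk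
      push Not at h
      calc f j * m ^ d ≤ j ^ d * f 1 * m ^ d := Nat.mul_le_mul_right _ h.le
        _ = j ^ d * (m ^ d * f 1) := by ring
        _ ≤ _ := Nat.mul_le_mul_left _ hmP
  have hmd : 0 < m ^ d := by positivity
  set q := k / m with hq
  have hq1 : 1 ≤ q := (Nat.one_le_div_iff (by omega)).2 hmk
  have hqk : m * q ≤ k := Nat.mul_div_le k m
  have hkq : k < m * (q + 1) := Nat.lt_mul_div_succ k (by omega)
  refine ⟨m, q, hm1, hq1, hqk, hkq.le, fun j hj hjq => ?_, ?_⟩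
  · have h := hgr (m * j) (Nat.le_mul_of_pos_right _ hj)
      ((Nat.mul_le_mul_left _ hjq).trans hqk)
    refine Nat.le_of_mul_le_mul_right (c := m ^ d) ?_ hmd
    calc _ ≤ _ := h
      _ = _ := by rw [mul_pow]; ring
  · refine Nat.le_of_mul_le_mul_right (c := m ^ d) ?_ hmd
    have hkq' : k ≤ 2 * q * m := by nlinarith
    calc T * f (m * q) * m ^ d ≤ T * f k * m ^ d :=
          Nat.mul_le_mul_right _ (Nat.mul_le_mul_left _ (hf hqk))
      _ ≤ k ^ d * f 1 * m ^ d := Nat.mul_le_mul_right _ hT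
      _ = k ^ d * (m ^ d * f 1) := by ring
      _ ≤ (2 * q * m) ^ d * f m := Nat.mul_le_mul (Nat.pow_le_pow_left hkq' d) hmP
      _ = _ := by rw [mul_pow]; ring

/-- A function of polynomial growth has a scale with small doubling and small increment. -/
lemma exists_slow_growth_scale {g : ℕ → ℕ} (hg : Monotone g) (h1 : 1 ≤ g 1) (d : ℕ) {q : ℕ}
    (hq : 4 ^ (6 * d + 8) ≤ q) (hgq : ∀ j, 1 ≤ j → j ≤ q → g j ≤ j ^ d * g 1) :
    ∃ n, 1 ≤ n ∧ n ≤ 4 ^ (6 * d + 8) ∧ g (2 * n) ≤ 16 ^ d * g n ∧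
      256 * 4 ^ d * g (n + 1) ≤ (256 * 4 ^ d + 1) * g n := by
  obtain ⟨i, hi, hi', hgi⟩ : ∃ i, 3 * d + 4 ≤ i ∧ i < 6 * d + 8 ∧
      g (4 ^ (i + 1)) ≤ 16 ^ d * g (4 ^ i) := by
    by_contra! H
    have key : ∀ t, t ≤ 3 * d + 4 → (16 ^ d) ^ t * g 1 ≤ g (4 ^ (3 * d + 4 + t)) := by
      intro t
      induction t with
      | zero =>
        intro _
        simpa using hg (show 1 ≤ 4 ^ (3 * d + 4) from Nat.one_le_pow _ _ (by norm_num))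
      | succ t ih =>
        intro ht
        have h2 := H (3 * d + 4 + t) (by omega) (by omega)
        calc (16 ^ d) ^ (t + 1) * g 1 = 16 ^ d * ((16 ^ d) ^ t * g 1) := by ring
          _ ≤ 16 ^ d * g (4 ^ (3 * d + 4 + t)) := Nat.mul_le_mul_left _ (ih (by omega))
          _ ≤ _ := h2.le
    have h2 := key (3 * d + 3) (by omega)
    have h3 := H (3 * d + 4 + (3 * d + 3)) (by omega) (by omega)
    have h4 := hgq (4 ^ (6 * d + 8)) (Nat.one_le_pow _ _ (by norm_num)) hq
    have e1 : 3 * d + 4 + (3 * d + 3) + 1 = 6 * d + 8 := by ring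
    rw [e1] at h3
    have e2 : ((4 : ℕ) ^ (6 * d + 8)) ^ d = 16 ^ d * (16 ^ d) ^ (3 * d + 3) := by
      rw [← pow_succ', ← pow_mul, ← pow_mul, show (16 : ℕ) = 4 ^ 2 by norm_num, ← pow_mul]
      congr 1; ring
    rw [e2, mul_assoc] at h4
    have h5 := Nat.mul_le_mul_left (16 ^ d) h2
    omega
  set p := 4 ^ i with hp
  have hp1 : 1 ≤ p := Nat.one_le_pow _ _ (by norm_num)
  have hpM : 256 * 4 ^ d * 16 ^ d ≤ p := by
    calc 256 * 4 ^ d * 16 ^ d = 4 ^ (3 * d + 4) := by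
          rw [show (16 : ℕ) = 4 ^ 2 by norm_num, show (256 : ℕ) = 4 ^ 4 by norm_num, ← pow_mul,
            ← pow_add, ← pow_add]
          congr 1; ring
      _ ≤ p := Nat.pow_le_pow_right (by norm_num) hi
  have hp4 : 4 * p ≤ 4 ^ (6 * d + 8) := by
    rw [hp, ← pow_succ']
    exact Nat.pow_le_pow_right (by norm_num) hi'
  rw [pow_succ', ← hp] at hgi
  have hgp : 1 ≤ g p := h1.trans (hg hp1)
  obtain ⟨n, hpn, hn, hstep⟩ : ∃ n, p ≤ n ∧ n < 2 * p ∧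
      256 * 4 ^ d * g (n + 1) ≤ (256 * 4 ^ d + 1) * g n := by
    by_contra! H
    have key : ∀ s, s ≤ p → 256 * 4 ^ d * g p + s * g p ≤ 256 * 4 ^ d * g (p + s) := by
      intro s
      induction s with
      | zero => intro _; simp
      | succ s ih =>
        intro hs
        have h2 := H (p + s) (by omega) (by omega)
        have h3 := ih (by omega)
        have h4 : g p ≤ g (p + s) := hg (by omega)
        rw [← add_assoc p]
        nlinarith
    have h2 := key p le_rfl
    have h3 : g (p + p) ≤ 16 ^ d * g p := (hg (by omega)).trans hgi
    have h4 : 256 * 4 ^ d * g (p + p) ≤ p * g p := by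
      calc _ ≤ 256 * 4 ^ d * (16 ^ d * g p) := Nat.mul_le_mul_left _ h3
        _ = 256 * 4 ^ d * 16 ^ d * g p := by ring
        _ ≤ _ := Nat.mul_le_mul_right _ hpM
    have h5 : 0 < 256 * 4 ^ d * g p := by positivity
    omega
  exact ⟨n, by omega, by omega, (hg (by omega)).trans
    (hgi.trans (Nat.mul_le_mul_left _ (hg hpn))), hstep⟩

section DominatingMinor

open Matrix

/-- Among finitely many vectors spanning `ℤ^r` there are `r` vectors, spanning a sublattice of
maximal index, modulo three times which the given vectors are distinguished. -/
lemma exists_dominating_vectors {ι : Type*} [Finite ι] {r : ℕ} (v : ι → Fin r → ℤ)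
    (hv : Submodule.span ℤ (Set.range v) = ⊤) :
    ∃ w : Fin r → ι, ∀ (a a' : ι) (δ : Fin r → ℤ),
      v a - v a' + 3 • ∑ i, δ i • v (w i) = 0 → δ = 0 := by
  classical
  have := Fintype.ofFinite ι
  let M : (Fin r → ι) → Matrix (Fin r) (Fin r) ℤ := fun w => Matrix.of fun i => v (w i)
  have hex : ∃ w, (M w).det ≠ 0 := by
    by_contra! H
    have hP : ∀ j : Fin r, ∃ P : ι → ℤ, ∑ a, P a • v a = (1 : Matrix (Fin r) (Fin r) ℤ) j := by
      intro j
      exact (Submodule.mem_span_range_iff_exists_fun ℤ).1 (by rw [hv]; trivial)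
    choose P hP using hP
    have h1 : (1 : Matrix (Fin r) (Fin r) ℤ).det = 0 := by
      have h2 : (1 : Matrix (Fin r) (Fin r) ℤ) = fun j => ∑ a, P j a • v a :=
        funext fun j => (hP j).symm
      have h3 := (Matrix.detRowAlternating (n := Fin r) (R := ℤ)).toMultilinearMap.map_sum
        (fun j a => P j a • v a)
      rw [h2]
      change Matrix.detRowAlternating.toMultilinearMap _ = _
      rw [h3]
      refine Finset.sum_eq_zero fun w _ => ?_
      rw [MultilinearMap.map_smul_univ]
      have h4 : (Matrix.detRowAlternating (n := Fin r) (R := ℤ)).toMultilinearMap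
        (fun i => v (w i)) = 0 := H w
      rw [h4, smul_zero]
    simp at h1
  obtain ⟨w₀, hw₀⟩ := hex
  have : Nonempty (Fin r → ι) := ⟨w₀⟩
  obtain ⟨w, hw⟩ := Finite.exists_max fun w => |(M w).det|
  have hdet : (M w).det ≠ 0 := abs_pos.1 ((abs_pos.2 hw₀).trans_le (hw w₀))
  refine ⟨w, fun a a' δ h => ?_⟩
  have hsum : ∑ i, δ i • v (w i) = (M w)ᵀ *ᵥ δ := by
    ext j
    simp [Matrix.mulVec, dotProduct, M, mul_comm]
  have hc : ∀ a i, |(M w)ᵀ.cramer (v a) i| ≤ |(M w).det| := by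
    intro a i
    rw [Matrix.cramer_transpose_apply]
    have : (M w).updateRow i (v a) = M (Function.update w i a) := by
      ext k j
      by_cases hk : k = i
      · subst hk; simp [M, Matrix.updateRow_apply]
      · simp [M, Matrix.updateRow_apply, hk]
    rw [this]
    exact hw _
  have hz : (M w)ᵀ *ᵥ ((M w)ᵀ.cramer (v a) - (M w)ᵀ.cramer (v a')
      + (3 * (M w).det) • δ) = 0 := by
    rw [Matrix.mulVec_add, Matrix.mulVec_sub, Matrix.mulVec_cramer, Matrix.mulVec_cramer,
      Matrix.mulVec_smul, ← hsum, Matrix.det_transpose]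
    calc _ = (M w).det • (v a - v a' + 3 • ∑ i, δ i • v (w i)) := by
          rw [smul_add, smul_sub, mul_comm, mul_smul]
          simp
      _ = 0 := by rw [h, smul_zero]
  have hz' := Matrix.eq_zero_of_mulVec_eq_zero (by rwa [Matrix.det_transpose]) hz
  ext i
  have hi := congrFun hz' i
  simp only [Pi.add_apply, Pi.sub_apply, Pi.smul_apply, smul_eq_mul, Pi.zero_apply] at hi
  have h1 := hc a i
  have h2 := hc a' i
  have h3 : 3 * |(M w).det| * |δ i| ≤ 2 * |(M w).det| := by
    have h4 : |3 * (M w).det * δ i| ≤ 2 * |(M w).det| := by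
      rw [show 3 * (M w).det * δ i = (M w)ᵀ.cramer (v a') i - (M w)ᵀ.cramer (v a) i by linarith]
      exact (abs_sub _ _).trans (by linarith)
    rw [abs_mul, abs_mul] at h4
    simpa using h4
  have h5 : 0 < |(M w).det| := abs_pos.2 hdet
  by_contra hne
  have h6 : 1 ≤ |δ i| := Int.one_le_abs hne
  nlinarith

end DominatingMinor

section RankBound

variable {G : Type*} [AddCommGroup G]

lemma sum_nsmul_mem_nsmul [DecidableEq G] {A : Finset G} (h0 : 0 ∈ A) {κ : Type*} (I : Finset κ)
    (w : κ → G) (hw : ∀ i, w i ∈ A) (j : ℕ) (n : κ → ℕ) (hn : ∀ i, n i ≤ j) :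
    ∑ i ∈ I, n i • w i ∈ (I.card * j) • A := by
  classical
  induction I using Finset.induction_on with
  | empty => simp
  | insert i I hi ih =>
    rw [Finset.sum_insert hi, Finset.card_insert_of_notMem hi, add_comm I.card, add_mul, one_mul,
      add_nsmul]
    exact Finset.add_mem_add (Finset.nsmul_subset_nsmul_right h0 (hn i)
      (Finset.nsmul_mem_nsmul (hw i))) ih

/-- A set containing `r` suitably independent elements has at least polynomial growth of
degree `r`. -/
lemma pow_mul_card_le_card_nsmul [DecidableEq G] {A : Finset G} (h0 : 0 ∈ A) {r : ℕ}
    (w : Fin r → G) (hw : ∀ i, w i ∈ A) (j : ℕ)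
    (hind : ∀ a ∈ A, ∀ a' ∈ A, ∀ δ : Fin r → ℤ, (∀ i, |δ i| ≤ j) →
      a - a' + 3 • ∑ i, δ i • w i = 0 → δ = 0) :
    j ^ r * A.card ≤ ((1 + 3 * (r * j)) • A).card := by
  have hcard : ((Finset.univ : Finset (Fin r → Fin j)) ×ˢ A).card = j ^ r * A.card := by
    rw [Finset.card_product]; simp
  rw [← hcard]
  refine Finset.card_le_card_of_injOn
    (fun p => p.2 + 3 • ∑ i, (p.1 i : ℕ) • w i) ?_ ?_
  · rintro ⟨n, a⟩ hp
    have ha : a ∈ A := (Finset.mem_product.1 (Finset.mem_coe.1 hp)).2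
    have h1 := sum_nsmul_mem_nsmul h0 Finset.univ w hw j (fun i => (n i : ℕ))
      (fun i => (n i).2.le)
    have h2 := Finset.nsmul_mem_nsmul (n := 3) h1
    rw [Finset.card_univ, Fintype.card_fin, ← mul_nsmul'] at h2
    rw [add_nsmul, one_nsmul]
    exact Finset.mem_coe.2 (Finset.add_mem_add ha h2)
  · rintro ⟨n, a⟩ hp ⟨n', a'⟩ hp' h
    have ha : a ∈ A := (Finset.mem_product.1 (Finset.mem_coe.1 hp)).2
    have ha' : a' ∈ A := (Finset.mem_product.1 (Finset.mem_coe.1 hp')).2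
    simp only at h
    have hδ := hind a ha a' ha' (fun i => (n i : ℤ) - (n' i : ℤ)) (fun i => by
      have := (n i).2
      have := (n' i).2
      rw [abs_le]; constructor <;> omega) (by
      simp only [sub_smul, Finset.sum_sub_distrib, natCast_zsmul, smul_sub]
      rw [sub_add_sub_comm, h, sub_self])
    have hn : n = n' := by
      ext i
      have := congrFun hδ i
      simp only [Pi.zero_apply] at this
      omega
    subst hn
    simpa using h

lemma exists_lift_of_mem_nsmul [DecidableEq G] {N : ℕ} {V : Type*} [AddCommGroup V]
    {A : Finset G} {H : AddSubgroup G} {φ : (Fin N → ℤ) →+ G} {L : Fin N → ℕ}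
    (c : (Fin N → ℤ) →+ V) (S : Submodule ℤ V)
    (hA : ∀ a ∈ A, ∃ y ∈ intBox L, a - φ y ∈ H ∧ c y ∈ S) (t : ℕ) :
    ∀ g ∈ t • A, ∃ y ∈ intBox (t • L), g - φ y ∈ H ∧ c y ∈ S := by
  induction t with
  | zero =>
    intro g hg
    rw [zero_nsmul, Finset.mem_zero] at hg
    exact ⟨0, zero_mem_intBox _, by rw [hg, map_zero, sub_zero]; exact zero_mem _,
      by rw [map_zero]; exact zero_mem _⟩
  | succ t ih =>
    intro g hg
    rw [succ_nsmul] at hg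
    obtain ⟨x, hx, a, ha, rfl⟩ := Finset.mem_add.1 hg
    obtain ⟨y, hy, hy1, hy2⟩ := ih x hx
    obtain ⟨z, hz, hz1, hz2⟩ := hA a ha
    refine ⟨y + z, ?_, ?_, by rw [map_add]; exact add_mem hy2 hz2⟩
    · rw [succ_nsmul]; exact intBox_add hy hz
    · rw [map_add, add_sub_add_comm]; exact add_mem hy1 hz1

lemma coe_nsmul_subset_cosetProg [DecidableEq G] {N : ℕ}
    {A : Finset G} {H : AddSubgroup G} {φ : (Fin N → ℤ) →+ G} {L : Fin N → ℕ}
    (hA : (A : Set G) ⊆ cosetProg H φ L) (t : ℕ) :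
    ((t • A : Finset G) : Set G) ⊆ cosetProg H φ (t • L) := by
  intro g hg
  obtain ⟨y, hy, hy1, -⟩ := exists_lift_of_mem_nsmul (0 : (Fin N → ℤ) →+ ℤ) ⊤
    (fun a ha => by
      obtain ⟨y, hy, h⟩ := hA ha
      exact ⟨y, hy, h, trivial⟩) t g (Finset.mem_coe.1 hg)
  exact ⟨y, hy, hy1⟩

/-- A set sandwiched between coset progressions contains as many independent elements as the
rank of the relation-free part of the progression. -/
lemma exists_independent_of_sandwich [DecidableEq G] {N r C Q j : ℕ}
    {A : Finset G} {H : AddSubgroup G} {φ : (Fin N → ℤ) →+ G} {L : Fin N → ℕ}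
    (hL : ∀ i, 1 ≤ L i) (hA : (A : Set G) ⊆ cosetProg H φ L)
    (hC : cosetProg H φ L ⊆ iterDiff A C)
    (c : (Fin N → ℤ) →+ (Fin r → ℤ)) (hc : Function.Surjective c)
    (hrel : ∀ ρ ∈ intBox (Q • L), φ ρ ∈ H → c ρ = 0) (hCQ : 2 * C + 1 ≤ Q)
    (hj : 2 + 3 * (r * j) ≤ Q) :
    ∃ w : Fin r → G, (∀ i, w i ∈ A) ∧ ∀ a ∈ A, ∀ a' ∈ A, ∀ δ : Fin r → ℤ, (∀ i, |δ i| ≤ j) →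
      a - a' + 3 • ∑ i, δ i • w i = 0 → δ = 0 := by
  classical
  choose x hx hxH using fun a : A => hA a.2
  set v : A → Fin r → ℤ := fun a => c (x a) with hv
  set S := Submodule.span ℤ (Set.range v) with hS
  have hmono : ∀ {t : ℕ} {y : Fin N → ℤ}, y ∈ intBox (t • L) → t ≤ Q → y ∈ intBox (Q • L) :=
    fun hy ht => intBox_mono (fun i => Nat.mul_le_mul_right _ ht) hy
  have hlift := fun t => exists_lift_of_mem_nsmul (H := H) (φ := φ) (L := L) c S
    (A := A) (fun a ha => ⟨x ⟨a, ha⟩, hx _, hxH ⟨a, ha⟩, Submodule.subset_span ⟨⟨a, ha⟩, rfl⟩⟩) t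
  have hspan : S = ⊤ := by
    have hsingle : ∀ l, c (Pi.single l 1) ∈ S := by
      intro l
      have hbox : (Pi.single l 1 : Fin N → ℤ) ∈ intBox L := by
        intro i
        have := hL i
        by_cases h : i = l
        · subst h; simp; omega
        · simp [h]
      have hmem := hC ⟨_, hbox, show φ (Pi.single l 1) - _ ∈ H by rw [sub_self]; exact zero_mem _⟩
      obtain ⟨g₁, hg₁, g₂, hg₂, hg⟩ := Finset.mem_sub.1 (Finset.mem_coe.1 hmem)
      obtain ⟨y₁, hy₁, hy₁H, hy₁S⟩ := hlift C g₁ hg₁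
      obtain ⟨y₂, hy₂, hy₂H, hy₂S⟩ := hlift C g₂ hg₂
      have hbox' : Pi.single l 1 - (y₁ - y₂) ∈ intBox ((2 * C + 1) • L) := by
        have := intBox_sub hbox (intBox_sub hy₁ hy₂)
        refine intBox_mono (fun i => ?_) this
        simp only [Pi.add_apply, Pi.smul_apply, smul_eq_mul]
        apply le_of_eq; ring
      have h0 := hrel _ (hmono hbox' hCQ) (by
        rw [map_sub, map_sub, ← hg, sub_sub_sub_comm]
        exact sub_mem hy₁H hy₂H)
      rw [map_sub, map_sub, sub_eq_zero] at h0
      rw [h0]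
      exact sub_mem hy₁S hy₂S
    rw [eq_top_iff]
    intro z _
    obtain ⟨y, rfl⟩ := hc z
    have hy : y = ∑ l, y l • (Pi.single l 1 : Fin N → ℤ) := by
      ext i
      simp [Finset.sum_apply, Pi.single_apply]
    rw [hy, map_sum]
    refine sum_mem fun l _ => ?_
    rw [map_zsmul]
    exact S.smul_mem _ (hsingle l)
  obtain ⟨w, hw⟩ := exists_dominating_vectors v hspan
  refine ⟨fun i => w i, fun i => (w i).2, fun a ha a' ha' δ hδ h => ?_⟩
  refine hw ⟨a, ha⟩ ⟨a', ha'⟩ δ ?_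
  have hbox : x ⟨a, ha⟩ - x ⟨a', ha'⟩ + 3 • ∑ i, δ i • x (w i) ∈
      intBox ((2 + 3 * (r * j)) • L) := by
    intro l
    have h1 := abs_le.1 (hx ⟨a, ha⟩ l)
    have h2 := abs_le.1 (hx ⟨a', ha'⟩ l)
    have h3 : |∑ i, δ i * x (w i) l| ≤ r * (j * L l) := by
      refine (Finset.abs_sum_le_sum_abs _ _).trans ?_
      refine (Finset.sum_le_card_nsmul _ _ ((j : ℤ) * L l) fun i _ => ?_).trans ?_
      · rw [abs_mul]
        exact mul_le_mul (hδ i) (hx (w i) l) (abs_nonneg _) (by positivity)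
      · simp
    have h4 := abs_le.1 h3
    simp only [Pi.add_apply, Pi.sub_apply, Pi.smul_apply, Finset.sum_apply, smul_eq_mul,
      nsmul_eq_mul, Pi.mul_apply, Pi.natCast_apply]
    rw [abs_le]
    push_cast
    constructor <;> nlinarith
  have h0 := hrel _ (hmono hbox hj) (by
    have : φ (x ⟨a, ha⟩ - x ⟨a', ha'⟩ + 3 • ∑ i, δ i • x (w i)) =
        -((a - φ (x ⟨a, ha⟩)) - (a' - φ (x ⟨a', ha'⟩))
          + 3 • ∑ i, δ i • ((w i : G) - φ (x (w i)))) := by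
      simp only [map_add, map_sub, map_nsmul, map_sum, map_zsmul, smul_sub,
        Finset.sum_sub_distrib]
      rw [eq_neg_iff_add_eq_zero, ← h]
      abel
    rw [this]
    exact neg_mem (add_mem (sub_mem (hxH ⟨a, ha⟩) (hxH ⟨a', ha'⟩)) (nsmul_mem (sum_mem fun i _ =>
      zsmul_mem (hxH _) _) _)))
  simpa only [map_add, map_sub, map_nsmul, map_sum, map_zsmul] using h0

end RankBound

section Structure

/-- Bound for the number of generators. -/
def rankConst (d : ℕ) : ℕ := 16 ^ (4 * d) * (4 ^ (6 * d + 8)) ^ d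

/-- Bound for the number of summands needed to cover a progression. -/
def sandwichConst (d : ℕ) : ℕ := 2 * 4 ^ (6 * d + 8) * (rankConst d + 1)

/-- Bound for the ratio between a progression and the sumset it contains. -/
def ratioConst (d : ℕ) : ℕ :=
  (2 * properConst (rankConst d) + 1) ^ rankConst d *
    (5 ^ rankConst d * (5 ^ rankConst d * 2 ^ d) ^ (2 * sandwichConst d + 1))

lemma reductionConst_mono : Monotone reductionConst := by
  refine monotone_nat_of_le_succ fun n => ?_
  change reductionConst n ≤ 4 * (n + 1) * reductionConst n + 1
  nlinarith [Nat.zero_le (n * reductionConst n)]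

lemma properConst_mono : Monotone properConst := by
  intro a b h
  have := reductionConst_mono h
  unfold properConst
  gcongr

variable {G : Type} [AddCommGroup G] [DecidableEq G]

lemma card_two_nsmul_sub_le {B : Finset G} (hB : B.Nonempty) {K : ℕ}
    (h : (B + B).card ≤ K * B.card) : (2 • B - 2 • B).card ≤ K ^ 4 * B.card := by
  have h1 := Finset.pluennecke_ruzsa_inequality_nsmul_sub_nsmul_add hB B 2 2
  have hpos : (0 : ℚ≥0) < B.card := by exact_mod_cast hB.card_pos
  have h2 : ((B + B).card / B.card : ℚ≥0) ≤ K := by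
    rw [div_le_iff₀ hpos]; exact_mod_cast h
  have h3 : ((2 • B - 2 • B).card : ℚ≥0) ≤ K ^ 4 * B.card :=
    h1.trans (mul_le_mul_of_nonneg_right (pow_le_pow_left₀ (by positivity) h2 _) hpos.le)
  exact_mod_cast h3

lemma exists_sandwich_of_growth {A : Finset G} (h0 : 0 ∈ A) {d q : ℕ}
    (hq : 4 ^ (6 * d + 8) ≤ q) (hgq : ∀ j, 1 ≤ j → j ≤ q → (j • A).card ≤ j ^ d * A.card) :
    ∃ (N : ℕ) (H : AddSubgroup G) (φ : (Fin N → ℤ) →+ G) (L : Fin N → ℕ),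
      N ≤ rankConst d ∧ (H : Set G).Finite ∧ (∀ i, 1 ≤ L i) ∧
      (A : Set G) ⊆ cosetProg H φ L ∧ cosetProg H φ L ⊆ iterDiff A (sandwichConst d) := by
  have hAne : 1 ≤ A.card := Finset.card_pos.2 ⟨0, h0⟩
  obtain ⟨n, hn, hn', h2, hstep⟩ := exists_slow_growth_scale (g := fun j => (j • A).card)
    (fun a b h => Finset.card_le_card (Finset.nsmul_subset_nsmul_right h0 h)) (by simpa using ⟨0, h0⟩) d hq
    (by simpa using hgq)
  rw [two_mul, add_nsmul] at h2
  rw [succ_nsmul] at hstep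
  obtain ⟨N, H, φ, L, hN, hH, hL, hA, hC⟩ := exists_sandwich A h0 d n hn h2 hstep
  have hNr : N ≤ rankConst d := by
    refine Nat.le_of_mul_le_mul_right (c := A.card) ?_ hAne
    calc N * A.card ≤ (16 ^ d) ^ 4 * (n • A).card :=
          hN.trans (card_two_nsmul_sub_le (Finset.Nonempty.nsmul ⟨0, h0⟩) h2)
      _ ≤ (16 ^ d) ^ 4 * (n ^ d * A.card) := Nat.mul_le_mul_left _ (hgq n hn (hn'.trans hq))
      _ ≤ 16 ^ (4 * d) * ((4 ^ (6 * d + 8)) ^ d * A.card) := by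
          rw [← pow_mul, mul_comm d 4]; gcongr
      _ = _ := by rw [rankConst]; ring
  refine ⟨N, H, φ, L, hNr, hH, hL, hA, hC.trans (iterDiff_mono h0 ?_)⟩
  unfold sandwichConst
  gcongr

theorem exists_cosetProg_rank_lt {A : Finset G} (h0 : 0 ∈ A) {d q T : ℕ} (hd : 1 ≤ d)
    (hq : 4 ^ (6 * d + 8) ≤ q) (hq' : sandwichConst d ≤ q) (hq'' : 3 * rankConst d + 1 ≤ q)
    (hgq : ∀ j, 1 ≤ j → j ≤ q → (j • A).card ≤ j ^ d * A.card)
    (hT : T * (q • A).card ≤ (2 * q) ^ d * A.card) (hTd : (12 * rankConst d) ^ d < T) :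
    ∃ (r : ℕ) (H : AddSubgroup G) (φ : (Fin r → ℤ) →+ G) (L : Fin r → ℕ), r < d ∧
      (H : Set G).Finite ∧ (((q + 1) • A : Finset G) : Set G) ⊆ cosetProg H φ L ∧
      (cosetProg H φ L).ncard ≤ ratioConst d * (q • A).card := by
  have hAne : 1 ≤ A.card := Finset.card_pos.2 ⟨0, h0⟩
  obtain ⟨N, H, φ, L, hN, hH, hL, hA, hC⟩ := exists_sandwich_of_growth h0 hq hgq
  have hq2 : 2 ≤ q := le_trans (le_trans (by norm_num)
    (Nat.pow_le_pow_right (by norm_num) (show 1 ≤ 6 * d + 8 by omega))) hq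
  set i := Nat.log 2 q with hi
  have hi1 : 2 ^ i ≤ q := Nat.pow_log_le_self 2 (by omega)
  have hi2 : q < 2 ^ (i + 1) := Nat.lt_pow_succ_log_self (by norm_num) q
  set Q := 2 ^ (i + 1) with hQ
  obtain ⟨r, H', c, ψ, L', hr, hHH', hH', hc, hφψ, hbox, hrel, -, hsub⟩ :=
    exists_proper_cosetProg φ H hH (Q • L) (fun l => Nat.one_le_iff_ne_zero.2
      (mul_ne_zero (by omega) (by have := hL l; omega)))
  rw [Fintype.card_fin] at hr hsub
  refine ⟨r, H', ψ, L', ?_, hH', ?_, ?_⟩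
  · by_contra! hdr
    have hr0 : 0 < 3 * r := by omega
    set j := (q - 1) / (3 * r) with hj
    have hj1 : 3 * r * j ≤ q - 1 := Nat.mul_div_le _ _
    have hj2 : q - 1 < 3 * r * (j + 1) := Nat.lt_mul_div_succ _ hr0
    have hj0 : 1 ≤ j := (Nat.one_le_div_iff hr0).2 (by omega)
    rw [← mul_nsmul'] at hrel
    obtain ⟨w, hw, hind⟩ := exists_independent_of_sandwich (Q := 4 * Q) (j := j) hL hA hC c hc
      hrel (by omega) (by rw [← mul_assoc]; omega)
    have h1 := pow_mul_card_le_card_nsmul h0 w hw j hind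
    have h2 : ((1 + 3 * (r * j)) • A).card ≤ (q • A).card :=
      Finset.card_le_card (Finset.nsmul_subset_nsmul_right h0 (by rw [← mul_assoc]; omega))
    have h3 : 2 * q ≤ 12 * rankConst d * j := by
      have h3 : 3 * r * (j + 1) ≤ 3 * r * (2 * j) := Nat.mul_le_mul_left _ (by omega)
      have h4 : 12 * r * j ≤ 12 * rankConst d * j := by
        gcongr; exact hr.trans hN
      have h5 : 12 * r * j = 2 * (3 * r * (2 * j)) := by ring
      omega
    have hjd : 0 < j ^ d * A.card := by positivity
    have h4 : T * (j ^ d * A.card) ≤ (12 * rankConst d) ^ d * (j ^ d * A.card) := by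
      calc T * (j ^ d * A.card) ≤ T * (j ^ r * A.card) := by gcongr
        _ ≤ T * (q • A).card := Nat.mul_le_mul_left _ (h1.trans h2)
        _ ≤ (2 * q) ^ d * A.card := hT
        _ ≤ (12 * rankConst d * j) ^ d * A.card := by gcongr
        _ = _ := by rw [mul_pow]; ring
    exact absurd (Nat.le_of_mul_le_mul_right h4 hjd) (by omega)
  · refine (coe_nsmul_subset_cosetProg hA (q + 1)).trans ?_
    refine (cosetProg_mono fun l => Nat.mul_le_mul_right _ hi2).trans ?_
    rintro g ⟨m, hm, hg⟩
    refine ⟨c m, hbox m hm, ?_⟩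
    have := add_mem (hHH' hg) (hφψ m)
    rwa [sub_add_sub_cancel] at this
  · have h1 : (cosetProg H φ (2 ^ i • L)).ncard ≤
        (5 ^ rankConst d * 2 ^ d) ^ (2 * sandwichConst d + 1) * (2 ^ i • A).card := by
      refine ncard_cosetProg_le_of_sandwich hH φ L hL A h0 hC ?_ ?_ i
      · rw [Fintype.card_fin]
        exact (Nat.pow_le_pow_right (by norm_num) hN).trans
          (Nat.le_mul_of_pos_right _ (by positivity))
      · refine (hgq 2 (by norm_num) hq2).trans (Nat.mul_le_mul_right _ ?_)
        exact Nat.le_mul_of_pos_left _ (by positivity)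
    have hone : ∀ t, 1 ≤ t → (fun l => max ((t • L) l) 1) = t • L := fun t ht => by
      funext l
      exact max_eq_left (Nat.mul_pos ht (hL l))
    have h2 := ncard_cosetProg_le hH φ (2 ^ i • L) 2
    rw [hone _ Nat.one_le_two_pow, Fintype.card_fin, ← mul_nsmul', ← pow_succ'] at h2
    have h3 := ncard_cosetProg_le hH φ (Q • L) (properConst N)
    rw [hone _ (by omega), Fintype.card_fin] at h3
    have h4 : (cosetProg H' ψ L').ncard ≤ (cosetProg H φ (properConst N • Q • L)).ncard :=
      Set.ncard_le_ncard hsub (finite_cosetProg hH _ _)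
    have h5 : (2 ^ i • A).card ≤ (q • A).card :=
      Finset.card_le_card (Finset.nsmul_subset_nsmul_right h0 hi1)
    have h6 : (2 * properConst N + 1) ^ N ≤
        (2 * properConst (rankConst d) + 1) ^ rankConst d := by
      have := properConst_mono hN
      calc _ ≤ (2 * properConst N + 1) ^ rankConst d := Nat.pow_le_pow_right (by omega) hN
        _ ≤ _ := by gcongr
    have h7 : (2 * 2 + 1) ^ N ≤ 5 ^ rankConst d := Nat.pow_le_pow_right (by norm_num) hN
    calc (cosetProg H' ψ L').ncard
        ≤ (2 * properConst N + 1) ^ N * (cosetProg H φ (Q • L)).ncard := h4.trans h3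
      _ ≤ (2 * properConst (rankConst d) + 1) ^ rankConst d * (5 ^ rankConst d *
            ((5 ^ rankConst d * 2 ^ d) ^ (2 * sandwichConst d + 1) * (q • A).card)) := by
          refine Nat.mul_le_mul h6 (h2.trans (Nat.mul_le_mul h7 (h1.trans ?_)))
          exact Nat.mul_le_mul_left _ h5
      _ = _ := by rw [ratioConst]; ring

end Structure

section Numerics

lemma reductionConst_le_pow {M n : ℕ} (hM : 1 ≤ M) (hn : n ≤ M) :
    reductionConst n ≤ (5 * M) ^ n := by
  induction n with
  | zero => simp [reductionConst]
  | succ n ih =>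
    have h1 := ih (by omega)
    have h2 := one_le_reductionConst n
    calc reductionConst (n + 1) = 4 * (n + 1) * reductionConst n + 1 := rfl
      _ ≤ 4 * M * reductionConst n + M * reductionConst n := by
          refine Nat.add_le_add (by gcongr) ?_
          nlinarith
      _ = 5 * M * reductionConst n := by ring
      _ ≤ 5 * M * (5 * M) ^ n := Nat.mul_le_mul_left _ h1
      _ = _ := (pow_succ' _ _).symm

lemma two_mul_properConst_add_one_le {M : ℕ} (hM : 1 ≤ M) :
    2 * properConst M + 1 ≤ (19 * M) ^ (M + 2) := by
  have h1 := reductionConst_le_pow hM le_rfl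
  have h2 : (5 * M) ^ M ≤ (19 * M) ^ M := by gcongr; norm_num
  have h3 := h1.trans h2
  have h4 := one_le_reductionConst M
  set R := reductionConst M
  calc 2 * properConst M + 1 = 2 * (M * R + M * (4 * (M + 1) * R)) + 1 := rfl
    _ = (8 * M * M + 10 * M) * R + 1 := by ring
    _ ≤ (8 * M * M + 10 * M) * R + M * M * R := by
        have : 1 ≤ M * M * R := Nat.mul_pos (Nat.mul_pos hM hM) h4
        omega
    _ ≤ (19 * M) ^ 2 * R := by
        rw [← add_mul]
        refine Nat.mul_le_mul_right _ ?_
        nlinarith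
    _ ≤ (19 * M) ^ 2 * (19 * M) ^ M := Nat.mul_le_mul_left _ h3
    _ = _ := by rw [← pow_add, add_comm]

variable {d : ℕ}

lemma rankConst_le (hd : 1 ≤ d) : rankConst d ≤ (2 ^ d ^ 2) ^ 44 := by
  unfold rankConst
  rw [show (16 : ℕ) = 2 ^ 4 by norm_num, show (4 : ℕ) = 2 ^ 2 by norm_num, ← pow_mul, ← pow_mul,
    ← pow_mul, ← pow_add, ← pow_mul]
  refine Nat.pow_le_pow_right (by norm_num) ?_
  nlinarith

lemma two_le_two_pow_sq (hd : 1 ≤ d) : 2 ≤ 2 ^ d ^ 2 := by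
  calc 2 = 2 ^ 1 := rfl
    _ ≤ _ := Nat.pow_le_pow_right (by norm_num) (Nat.one_le_pow _ _ hd)

lemma sandwichConst_le (hd : 1 ≤ d) : sandwichConst d ≤ (2 ^ d ^ 2) ^ 74 := by
  have h1 := rankConst_le hd
  have h2 : 4 ^ (6 * d + 8) ≤ (2 ^ d ^ 2) ^ 28 := by
    rw [show (4 : ℕ) = 2 ^ 2 by norm_num, ← pow_mul, ← pow_mul]
    refine Nat.pow_le_pow_right (by norm_num) ?_
    nlinarith
  have h3 := two_le_two_pow_sq hd
  set x := 2 ^ d ^ 2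
  have h4 : 1 ≤ x ^ 44 := Nat.one_le_pow _ _ (by omega)
  calc sandwichConst d ≤ 2 * x ^ 28 * (x ^ 44 + x ^ 44) := by unfold sandwichConst; gcongr
    _ = 2 * 2 * x ^ 72 := by ring
    _ ≤ x * x * x ^ 72 := by gcongr
    _ = _ := by ring

lemma two_mul_properConst_add_one_pow_le (hd : 1 ≤ d) {n : ℕ} (hn : n ≤ (2 ^ d ^ 2) ^ 44) :
    (2 * properConst n + 1) ^ n ≤ 2 ^ (2 ^ d ^ 2) ^ 96 := by
  have hx := two_le_two_pow_sq hd
  have hdx : d ^ 2 ≤ 2 ^ d ^ 2 := Nat.lt_two_pow_self.le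
  set x := 2 ^ d ^ 2 with hxdef
  set M := x ^ 44 with hM
  have hM2 : 2 ≤ M := hx.trans (Nat.le_self_pow (by norm_num) x)
  have h5 : 19 ≤ x ^ 5 := le_trans (by norm_num) (Nat.pow_le_pow_left hx 5)
  have h6 : 49 ≤ x ^ 6 := le_trans (by norm_num) (Nat.pow_le_pow_left hx 6)
  have h1 : 2 * properConst n + 1 ≤ 2 ^ x ^ 52 := by
    have := properConst_mono hn
    calc 2 * properConst n + 1 ≤ 2 * properConst M + 1 := by omega
      _ ≤ (19 * M) ^ (M + 2) := two_mul_properConst_add_one_le (by omega)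
      _ ≤ (x ^ 5 * M) ^ (M + 2) := by gcongr
      _ = 2 ^ (49 * d ^ 2 * (M + 2)) := by
          rw [hM, ← pow_add, hxdef, ← pow_mul, ← pow_mul]; congr 1; ring
      _ ≤ 2 ^ (x ^ 6 * x * (x * M)) := by
          refine Nat.pow_le_pow_right (by norm_num) ?_
          refine Nat.mul_le_mul (Nat.mul_le_mul h6 hdx) ?_
          nlinarith
      _ = 2 ^ x ^ 52 := by congr 1; rw [hM]; ring
  calc (2 * properConst n + 1) ^ n ≤ (2 ^ x ^ 52) ^ n := Nat.pow_le_pow_left h1 n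
    _ ≤ (2 ^ x ^ 52) ^ M := Nat.pow_le_pow_right (by positivity) hn
    _ = _ := by rw [← pow_mul, hM, ← pow_add]

lemma ratioConst_le (hd : 1 ≤ d) : ratioConst d ≤ 2 ^ ((2 ^ d ^ 2) ^ 96 + (2 ^ d ^ 2) ^ 124) := by
  have h1 := two_mul_properConst_add_one_pow_le hd (rankConst_le hd)
  have h2 := rankConst_le hd
  have h3 := sandwichConst_le hd
  have hx := two_le_two_pow_sq hd
  have hdx : d ≤ 2 ^ d ^ 2 := (Nat.le_self_pow (by norm_num) d).trans Nat.lt_two_pow_self.le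
  unfold ratioConst
  set x := 2 ^ d ^ 2 with hxdef
  have h4 : 5 ^ rankConst d ≤ 2 ^ x ^ 46 := by
    calc 5 ^ rankConst d ≤ (2 ^ 3) ^ rankConst d := by gcongr; norm_num
      _ ≤ (2 ^ 3) ^ x ^ 44 := by gcongr; norm_num
      _ = 2 ^ (3 * x ^ 44) := by rw [← pow_mul]
      _ ≤ 2 ^ (x ^ 2 * x ^ 44) := by gcongr <;> nlinarith
      _ = _ := by rw [← pow_add]
  have h46 : x ≤ x ^ 46 := Nat.le_self_pow (by norm_num) x
  have h5 : 5 ^ rankConst d * 2 ^ d ≤ 2 ^ x ^ 47 := by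
    calc 5 ^ rankConst d * 2 ^ d ≤ 2 ^ x ^ 46 * 2 ^ x ^ 46 := by
          gcongr; · norm_num
          exact hdx.trans h46
      _ = 2 ^ (2 * x ^ 46) := by rw [← pow_add]; congr 1; ring
      _ ≤ 2 ^ (x * x ^ 46) := by gcongr; norm_num
      _ = _ := by rw [← pow_succ']
  have h6 : 2 * sandwichConst d + 1 ≤ x ^ 76 := by
    have : 1 ≤ x ^ 74 := Nat.one_le_pow _ _ (by omega)
    calc 2 * sandwichConst d + 1 ≤ 2 * 2 * x ^ 74 := by omega
      _ ≤ x * x * x ^ 74 := by gcongr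
      _ = _ := by ring
  have h7 : (5 ^ rankConst d * 2 ^ d) ^ (2 * sandwichConst d + 1) ≤ 2 ^ x ^ 123 := by
    calc _ ≤ (2 ^ x ^ 47) ^ (2 * sandwichConst d + 1) := Nat.pow_le_pow_left h5 _
      _ ≤ (2 ^ x ^ 47) ^ x ^ 76 := Nat.pow_le_pow_right (by positivity) h6
      _ = _ := by rw [← pow_mul, ← pow_add]
  have h8 : x ^ 46 + x ^ 123 ≤ x ^ 124 := by
    have : x ^ 46 ≤ x ^ 123 := Nat.pow_le_pow_right (by omega) (by norm_num)
    calc x ^ 46 + x ^ 123 ≤ 2 * x ^ 123 := by omega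
      _ ≤ x * x ^ 123 := by gcongr
      _ = _ := by ring
  calc _ ≤ 2 ^ x ^ 96 * (2 ^ x ^ 46 * 2 ^ x ^ 123) :=
        Nat.mul_le_mul h1 (Nat.mul_le_mul h4 h7)
    _ = 2 ^ (x ^ 96 + (x ^ 46 + x ^ 123)) := by rw [← pow_add, ← pow_add]
    _ ≤ _ := Nat.pow_le_pow_right (by norm_num) (by omega)

lemma properConst_pow_mul_ratioConst_le (hd : 1 ≤ d) {n : ℕ} (hn : n ≤ d) :
    (2 * properConst n + 1) ^ n * ratioConst d ≤ 2 ^ (2 ^ d ^ 2) ^ 126 := by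
  have hx := two_le_two_pow_sq hd
  have hdx : d ≤ 2 ^ d ^ 2 := (Nat.le_self_pow (by norm_num) d).trans Nat.lt_two_pow_self.le
  have h1 := two_mul_properConst_add_one_pow_le hd
    (hn.trans (hdx.trans (Nat.le_self_pow (by norm_num : 44 ≠ 0) _)))
  have h2 := ratioConst_le hd
  set x := 2 ^ d ^ 2
  have h3 : x ^ 96 ≤ x ^ 124 := Nat.pow_le_pow_right (by omega) (by norm_num)
  have h4 : 4 * x ^ 124 ≤ x ^ 126 := by
    calc 4 * x ^ 124 = 2 * 2 * x ^ 124 := by ring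
      _ ≤ x * x * x ^ 124 := by gcongr
      _ = _ := by ring
  calc _ ≤ 2 ^ x ^ 96 * 2 ^ (x ^ 96 + x ^ 124) := Nat.mul_le_mul h1 h2
    _ = 2 ^ (x ^ 96 + (x ^ 96 + x ^ 124)) := by rw [← pow_add]
    _ ≤ _ := Nat.pow_le_pow_right (by norm_num) (by omega)

lemma two_mul_sandwichConst_pow_lt (hd : 1 ≤ d) :
    (2 * sandwichConst d) ^ d < 2 ^ (2 ^ d ^ 2) ^ 126 := by
  have hx := two_le_two_pow_sq hd
  have h1 := sandwichConst_le hd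
  have hdx : d ≤ 2 ^ d ^ 2 := (Nat.le_self_pow (by norm_num) d).trans Nat.lt_two_pow_self.le
  have hdx' : d ^ 2 ≤ 2 ^ d ^ 2 := Nat.lt_two_pow_self.le
  set x := 2 ^ d ^ 2 with hxdef
  have h7 : 75 ≤ x ^ 7 := le_trans (by norm_num) (Nat.pow_le_pow_left hx 7)
  calc (2 * sandwichConst d) ^ d ≤ (x * x ^ 74) ^ d := by gcongr
    _ = 2 ^ (75 * d ^ 2 * d) := by
        rw [← pow_succ', hxdef, ← pow_mul, ← pow_mul]; congr 1; ring
    _ ≤ 2 ^ (x ^ 7 * x * x) := by gcongr; norm_num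
    _ = 2 ^ x ^ 9 := by congr 1
    _ < _ := Nat.pow_lt_pow_right (by norm_num) (Nat.pow_lt_pow_right (by omega) (by norm_num))

end Numerics

section Translate

variable {G : Type*} [AddCommGroup G]

/-- A translate of a subset of a coset progression lies in a proper coset progression of rank at
most one more. -/
lemma exists_proper_cosetProg_translate {r : ℕ} {H : AddSubgroup G} (hH : (H : Set G).Finite)
    (φ : (Fin r → ℤ) →+ G) (L : Fin r → ℕ) (g : G) :
    ∃ (s : ℕ) (H' : AddSubgroup G) (ψ : (Fin s → ℤ) →+ G) (L' : Fin s → ℕ), s ≤ r + 1 ∧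
      (H' : Set G).Finite ∧ (∀ m ∈ intBox (4 • L'), ψ m ∈ H' → m = 0) ∧
      (∀ x ∈ cosetProg H φ L, g + x ∈ cosetProg H' ψ L') ∧
      (cosetProg H' ψ L').ncard ≤
        (2 * properConst (r + 1) + 1) ^ (r + 1) * (cosetProg H φ L).ncard := by
  let Φ : (Option (Fin r) → ℤ) →+ G :=
    { toFun := fun m => φ (fun i => m (some i)) + m none • g
      map_zero' := by
        have : (fun i : Fin r => (0 : Option (Fin r) → ℤ) (some i)) = 0 := rfl
        rw [this]; simp
      map_add' := fun a b => by
        have : (fun i : Fin r => (a + b) (some i)) = (fun i => a (some i)) + fun i => b (some i) :=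
          rfl
        rw [this, map_add, Pi.add_apply, add_smul]
        abel }
  let ℓ : Option (Fin r) → ℕ := fun o => o.elim 0 L
  obtain ⟨s, H', c, ψ, L', hs, hHH', hH', -, hφψ, hbox, -, hprop, hsub⟩ :=
    exists_proper_cosetProg Φ H hH (fun o => max (ℓ o) 1) fun o => le_max_right _ _
  rw [Fintype.card_option, Fintype.card_fin] at hs hsub
  refine ⟨s, H', ψ, L', hs, hH', hprop, ?_, ?_⟩
  · rintro x ⟨m, hm, hx⟩
    have hm' : (fun o : Option (Fin r) => o.elim 1 m) ∈ intBox fun o => max (ℓ o) 1 := by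
      rintro (_ | i)
      · simp [ℓ]
      · exact (hm i).trans (by exact_mod_cast le_max_left _ _)
    refine ⟨c _, hbox _ hm', ?_⟩
    have h1 := hφψ fun o : Option (Fin r) => o.elim 1 m
    have h2 : Φ (fun o : Option (Fin r) => o.elim 1 m) = φ m + g := by
      change φ (fun i => m i) + (1 : ℤ) • g = _
      rw [one_smul]
    rw [h2] at h1
    have h3 := add_mem (hHH' hx) h1
    convert h3 using 1
    abel
  · have h1 := ncard_cosetProg_le hH Φ ℓ (properConst (r + 1))
    rw [Fintype.card_option, Fintype.card_fin] at h1
    have h2 : cosetProg H Φ ℓ ⊆ cosetProg H φ L := by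
      rintro x ⟨m, hm, hx⟩
      refine ⟨fun i => m (some i), fun i => hm (some i), ?_⟩
      have h0 : m none = 0 := by simpa [ℓ] using hm none
      have h3 : Φ m = φ (fun i => m (some i)) := by
        change φ _ + m none • g = _
        rw [h0, zero_smul, add_zero]
      rwa [← h3]
    calc (cosetProg H' ψ L').ncard ≤ _ := Set.ncard_le_ncard hsub (finite_cosetProg hH _ _)
      _ ≤ _ := h1
      _ ≤ _ := Nat.mul_le_mul_left _ (Set.ncard_le_ncard h2 (finite_cosetProg hH _ _))

end Translate

section CosetProgressions

variable {G : Type*} [AddCommGroup G]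

/-- The symmetric progression with generators the images of the standard basis. -/
def symmetricGAP {r : ℕ} (ψ : (Fin r → ℤ) →+ G) (L : Fin r → ℕ) : GAPData G r where
  g₀ := 0
  g := fun i => ψ (Pi.single i 1)
  N := fun i => -(L i : ℤ)
  N' := fun i => L i
  hle := fun i => by omega

lemma sum_smul_apply_single {r : ℕ} (ψ : (Fin r → ℤ) →+ G) (m : Fin r → ℤ) :
    ∑ i, m i • ψ (Pi.single i 1) = ψ m := by
  have hm : m = ∑ i, m i • (Pi.single i 1 : Fin r → ℤ) := by
    ext i
    simp [Finset.sum_apply, Pi.single_apply]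
  conv_rhs => rw [hm, map_sum]
  simp only [map_zsmul]

lemma dilate_symmetricGAP {r : ℕ} (ψ : (Fin r → ℤ) →+ G) (L : Fin r → ℕ) (t : ℕ) :
    (symmetricGAP ψ L).dilate t = symmetricGAP ψ (t • L) := by
  simp only [symmetricGAP, GAPData.dilate, GAPData.mk.injEq, true_and]
  constructor <;> ext i <;> simp

lemma toSet_symmetricGAP {r : ℕ} (ψ : (Fin r → ℤ) →+ G) (L : Fin r → ℕ) :
    (symmetricGAP ψ L).toSet = ψ '' intBox L := by
  ext x
  constructor
  · rintro ⟨m, hm, rfl⟩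
    refine ⟨m, fun i => abs_le.2 (hm i), ?_⟩
    change _ = 0 + ∑ i, m i • ψ (Pi.single i 1)
    rw [zero_add, sum_smul_apply_single]
  · rintro ⟨m, hm, rfl⟩
    refine ⟨m, fun i => abs_le.1 (hm i), ?_⟩
    change _ = 0 + ∑ i, m i • ψ (Pi.single i 1)
    rw [zero_add, sum_smul_apply_single]

lemma add_toSet_symmetricGAP {r : ℕ} (H : AddSubgroup G) (ψ : (Fin r → ℤ) →+ G) (L : Fin r → ℕ) :
    (H : Set G) + (symmetricGAP ψ L).toSet = cosetProg H ψ L := by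
  rw [toSet_symmetricGAP]
  ext x
  constructor
  · rintro ⟨h, hh, _, ⟨m, hm, rfl⟩, rfl⟩
    exact ⟨m, hm, by simpa using hh⟩
  · rintro ⟨m, hm, hx⟩
    exact ⟨x - ψ m, hx, ψ m, ⟨m, hm, rfl⟩, by simp⟩

lemma isTProperCosetProg_symmetricGAP {r : ℕ} {H : AddSubgroup G} (hH : (H : Set G).Finite)
    (ψ : (Fin r → ℤ) →+ G) (L : Fin r → ℕ) (t : ℕ)
    (hprop : ∀ m ∈ intBox ((2 * t) • L), ψ m ∈ H → m = 0) :
    IsTProperCosetProg t H (symmetricGAP ψ L) := by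
  have hsub : ∀ m ∈ intBox (t • L), ∀ m' ∈ intBox (t • L), ψ m - ψ m' ∈ H → m = m' := by
    intro m hm m' hm' h
    have h1 := intBox_sub hm hm'
    rw [← two_nsmul, ← mul_nsmul'] at h1
    exact sub_eq_zero.1 (hprop _ h1 (by rwa [map_sub]))
  unfold IsTProperCosetProg
  rw [dilate_symmetricGAP]
  refine ⟨hH, ?_, ?_⟩
  · intro m m' hm hm' h
    refine hsub m (fun i => abs_le.2 (hm i)) m' (fun i => abs_le.2 (hm' i)) ?_
    have h1 : ψ m = ψ m' := by
      rw [← sum_smul_apply_single, ← sum_smul_apply_single]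
      exact add_left_cancel h
    rw [h1, sub_self]
    exact zero_mem _
  · rw [toSet_symmetricGAP, ← Set.add_image_prod, ← Set.ncard_prod]
    refine Set.InjOn.ncard_image ?_
    rintro ⟨h, _⟩ ⟨hh, m, hm, rfl⟩ ⟨h', _⟩ ⟨hh', m', hm', rfl⟩ heq
    simp only at heq hh hh'
    have hm : m = m' := by
      refine hsub m hm m' hm' ?_
      have : ψ m - ψ m' = h' - h := by
        rw [sub_eq_sub_iff_add_eq_add, add_comm, heq]
      rw [this]
      exact sub_mem hh' hh
    subst hm
    simpa using heq

lemma iterSumset_coe [DecidableEq G] (F : Finset G) (k : ℕ) :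
    iterSumset k (F : Set G) = ((k • F : Finset G) : Set G) := by
  induction k with
  | zero =>
    rw [zero_nsmul, Finset.coe_zero]
    exact Set.singleton_zero
  | succ k ih => rw [iterSumset, ih, succ_nsmul', Finset.coe_add]

end CosetProgressions

/-- A set whose sumset grows slowly is covered by a proper coset progression. -/
theorem exists_proper_cosetProg_of_growth {G : Type} [AddCommGroup G] [DecidableEq G] {d k T : ℕ}
    (hd : 1 ≤ d) (hk : 1 ≤ k) {F : Finset G} (hF : F.Nonempty)
    (hT : T * (k • F).card ≤ k ^ d * F.card) (hTd : 2 ^ (2 ^ d ^ 2) ^ 126 ≤ T) :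
    ∃ (s : ℕ) (H : AddSubgroup G) (ψ : (Fin s → ℤ) →+ G) (L : Fin s → ℕ), s ≤ d ∧
      (H : Set G).Finite ∧ (∀ m ∈ intBox (4 • L), ψ m ∈ H → m = 0) ∧
      ((k • F : Finset G) : Set G) ⊆ cosetProg H ψ L ∧
      (cosetProg H ψ L).ncard ≤ T * (k • F).card := by
  obtain ⟨x₀, hx₀⟩ := hF
  set Y : Finset G := {-x₀} + F with hY
  have hFY : F = {x₀} + Y := by
    rw [hY, ← add_assoc, Finset.singleton_add_singleton, add_neg_cancel]
    exact (zero_add F).symm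
  have h0Y : (0 : G) ∈ Y := by
    rw [hY, ← neg_add_cancel x₀]
    exact Finset.add_mem_add (Finset.mem_singleton_self _) hx₀
  have hkF : ∀ j : ℕ, j • F = {j • x₀} + j • Y := fun j => by
    rw [hFY, nsmul_add, Finset.nsmul_singleton]
  have hcard : ∀ j : ℕ, (j • F).card = (j • Y).card := fun j => by
    rw [hkF, Finset.card_singleton_add]
  have hYmono : Monotone fun j : ℕ => (j • Y).card := fun a b h =>
    Finset.card_le_card (Finset.nsmul_subset_nsmul_right h0Y h)
  obtain ⟨m, q, hm, hq, hmq, hkm, hgr, hTq⟩ := exists_polynomial_growth_scale hYmono d hk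
    (T := T) (by
      show T * (k • Y).card ≤ k ^ d * (1 • Y).card
      rwa [← hcard, ← hcard, one_nsmul])
  simp only [mul_nsmul] at hgr hTq
  set A := m • Y with hA
  have h0A : (0 : G) ∈ A := by
    have h := Finset.nsmul_mem_nsmul (n := m) h0Y
    rwa [nsmul_zero] at h
  have hqA : A.card ≤ (q • A).card := by
    have h := Finset.card_le_card (Finset.nsmul_subset_nsmul_right h0A hq)
    rwa [one_nsmul] at h
  have hApos : 0 < A.card := Finset.card_pos.2 ⟨0, h0A⟩
  have hTle : T ≤ (2 * q) ^ d := by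
    refine Nat.le_of_mul_le_mul_right (c := (q • A).card) ?_ (hApos.trans_le hqA)
    exact hTq.trans (Nat.mul_le_mul_left _ hqA)
  have hsT : (2 * sandwichConst d) ^ d < T := (two_mul_sandwichConst_pow_lt hd).trans_le hTd
  have hsq : sandwichConst d < q := by
    have := lt_of_pow_lt_pow_left₀ d (by positivity) (hsT.trans_le hTle)
    omega
  have h4 : 4 ^ 8 ≤ 4 ^ (6 * d + 8) := Nat.pow_le_pow_right (by norm_num) (by omega)
  have hsr : 2 * 4 ^ 8 * (rankConst d + 1) ≤ sandwichConst d := by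
    unfold sandwichConst
    gcongr
  have hsp : 4 ^ (6 * d + 8) ≤ sandwichConst d := by
    unfold sandwichConst
    nlinarith [Nat.zero_le (4 ^ (6 * d + 8) * rankConst d)]
  obtain ⟨r, H, φ, L, hr, hH, hsub, hφ⟩ := exists_cosetProg_rank_lt h0A hd (hsp.trans hsq.le)
    hsq.le (by omega) hgr hTq
    ((Nat.pow_le_pow_left (by omega) d).trans_lt hsT)
  obtain ⟨s, H', ψ, L', hs, hH', hprop, htrans, hψ⟩ :=
    exists_proper_cosetProg_translate hH φ L (k • x₀)
  refine ⟨s, H', ψ, L', by omega, hH', hprop, ?_, ?_⟩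
  · intro x hx
    rw [hkF] at hx
    obtain ⟨_, hx', y, hy, rfl⟩ := Finset.mem_add.1 (Finset.mem_coe.1 hx)
    rw [Finset.mem_singleton.1 hx']
    refine htrans y (hsub (Finset.mem_coe.2 ?_))
    rw [hA, ← mul_nsmul]
    exact Finset.nsmul_subset_nsmul_right h0Y hkm hy
  · have h5 : (q • A).card ≤ (k • F).card := by
      rw [hcard, hA, ← mul_nsmul]
      exact hYmono hmq
    have h6 := properConst_pow_mul_ratioConst_le hd (n := r + 1) hr
    calc (cosetProg H' ψ L').ncard ≤ _ := hψ
      _ ≤ (2 * properConst (r + 1) + 1) ^ (r + 1) * (ratioConst d * (k • F).card) :=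
          Nat.mul_le_mul_left _ (hφ.trans (Nat.mul_le_mul_left _ h5))
      _ = (2 * properConst (r + 1) + 1) ^ (r + 1) * ratioConst d * (k • F).card := by ring
      _ ≤ _ := Nat.mul_le_mul_right _ (h6.trans hTd)

theorem stmt14 :
    ∃ C₁ C₂ : ℕ, ∀ (G : Type) [AddCommGroup G], ∀ d k : ℕ, 1 ≤ d → 1 ≤ k →
      ∀ X : Set G, X.Finite → X.Nonempty →
        2 ^ 2 ^ (C₂ * d ^ 2 * 2 ^ (6 * d)) * (iterSumset k X).ncard ≤ k ^ d * X.ncard →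
        ∃ (d' : ℕ) (H : AddSubgroup G) (P : GAPData G d'),
          d' ≤ d ∧ P.IsSymmetric ∧ IsTProperCosetProg 2 H P ∧
          iterSumset k X ⊆ (H : Set G) + P.toSet ∧
          (((H : Set G) + P.toSet).ncard : ℝ) ≤
            (2 : ℝ) ^ d * ((C₁ * d : ℕ) : ℝ) ^ (3 * (d : ℝ) ^ 2 / 2) *
              (2 : ℝ) ^ (d * 2 ^ (C₂ * d ^ 2 * 2 ^ (6 * d))) *
              ((iterSumset k X).ncard : ℝ) := by
  classical
  refine ⟨1, 126, fun G _ d k hd hk X hXfin hXne hX => ?_⟩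
  set T := 2 ^ 2 ^ (126 * d ^ 2 * 2 ^ (6 * d)) with hT
  lift X to Finset G using hXfin
  rw [iterSumset_coe, Set.ncard_coe_finset, Set.ncard_coe_finset] at hX
  have hTd : 2 ^ (2 ^ d ^ 2) ^ 126 ≤ T := by
    rw [hT, ← pow_mul, mul_comm (d ^ 2)]
    exact Nat.pow_le_pow_right (by norm_num) (Nat.pow_le_pow_right (by norm_num)
      (Nat.le_mul_of_pos_right _ (by positivity)))
  obtain ⟨s, H, ψ, L, hs, hH, hprop, hsub, hcard⟩ :=
    exists_proper_cosetProg_of_growth hd hk (Finset.coe_nonempty.1 hXne) hX hTd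
  refine ⟨s, H, symmetricGAP ψ L, hs, ⟨rfl, fun i => rfl⟩,
    isTProperCosetProg_symmetricGAP hH ψ L 2 hprop, ?_, ?_⟩
  · rw [iterSumset_coe, add_toSet_symmetricGAP]
    exact hsub
  · rw [iterSumset_coe, add_toSet_symmetricGAP, Set.ncard_coe_finset]
    have h1 : ((cosetProg H ψ L).ncard : ℝ) ≤ (T : ℝ) * ((k • X).card : ℝ) := by
      exact_mod_cast hcard
    have hd' : (1 : ℝ) ≤ ((1 * d : ℕ) : ℝ) := by rw [one_mul]; exact_mod_cast hd
    have h2 : (1 : ℝ) ≤ 2 ^ d * ((1 * d : ℕ) : ℝ) ^ (3 * (d : ℝ) ^ 2 / 2) :=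
      one_le_mul_of_one_le_of_one_le (one_le_pow₀ (by norm_num))
        (Real.one_le_rpow hd' (by positivity))
    have h3 : (T : ℝ) ≤ (2 : ℝ) ^ (d * 2 ^ (126 * d ^ 2 * 2 ^ (6 * d))) := by
      rw [hT]
      push_cast
      exact pow_le_pow_right₀ (by norm_num) (Nat.le_mul_of_pos_left _ hd)
    refine h1.trans (mul_le_mul_of_nonneg_right ?_ (Nat.cast_nonneg _))
    exact h3.trans (le_mul_of_one_le_left (by positivity) h2)
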